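/- arXiv:1910.05532 — 3 statements merged into one kernel-verified Lean document; each statement's English description precedes it below -/
import Mathlib

section
/- Every \alpha \in \Delta_0^+ satisfies exactly one of the following three conditions: (a) \alpha \in \Delta_0'^+, i.e. the coordinates of \alpha at 0 and 6 both vanish; (b) \alpha + \sigma(\alpha) \in \mathbb{Z}_{>0}\cdot\delta; (c) there exists \beta \in \Delta_0' with \sigma(\beta) \ne \beta such that \alpha + \sigma(\alpha) = \delta + \beta + \sigma(\beta). -/
/-!
Statement 7: For the affine root system of type `E_7^{(1)}` with the admissible
diagram automorphism `σ : α_i ↦ α_{6-i}` (`0 ≤ i ≤ 6`), `σ(α_7) = α_7`, every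
`α ∈ Δ₀⁺` satisfies exactly one of:
(a) `α ∈ Δ₀'⁺` (coordinates at `0` and `6` vanish);
(b) `α + σ(α) ∈ ℤ_{>0}·δ`;
(c) `∃ β ∈ Δ₀'` with `σ(β) ≠ β` and `α + σ(α) = δ + β + σ(β)`.
-/

namespace Stmt7

/-- The root lattice `Q = ⨁_{i ∈ I} ℤ α_i` for `I = {0,1,…,7}`. -/
abbrev Q := Fin 8 → ℤ

/-- The edges of the Dynkin diagram of affine type `E_7^{(1)}`. -/
abbrev edge (i j : ℕ) : Prop :=
  (i + 1 = j ∧ j ≤ 6) ∨ (j + 1 = i ∧ i ≤ 6) ∨ (i = 3 ∧ j = 7) ∨ (i = 7 ∧ j = 3)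

/-- The generalized Cartan matrix of type `E_7^{(1)}`. -/
def CM (i j : Fin 8) : ℤ :=
  if i = j then 2 else if edge (i : ℕ) (j : ℕ) then -1 else 0

/-- The symmetric bilinear form `B` on `Q` determined by the Cartan matrix. -/
def B (v w : Q) : ℤ := ∑ i, ∑ j, v i * CM i j * w j

/-- The set of positive real roots. -/
def ΔrePos : Set Q := {v | (∀ i, 0 ≤ v i) ∧ B v v = 2}

/-- The set `Δ₀⁺` of positive roots of the finite root system of type `E_7`. -/
def Δ0Pos : Set Q := {v | v ∈ ΔrePos ∧ v 0 = 0}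

/-- The primitive null root `δ`. -/
def δ : Q := ![1, 2, 3, 4, 3, 2, 1, 2]

/-- The involution of the index set: `i ↦ 6-i` for `0 ≤ i ≤ 6`, `7 ↦ 7`. -/
def τ (i : Fin 8) : Fin 8 :=
  ⟨if (i : ℕ) = 7 then 7 else 6 - (i : ℕ), by have := i.isLt; split_ifs <;> omega⟩

/-- The admissible diagram automorphism `σ` (on coordinates). -/
def σmap (v : Q) : Q := fun i => v (τ i)

/-- The `σ`-stable subsystem `Δ₀'` of type `E_6` supported on `I ∖ {0, 6}`. -/
def Δ0' : Set Q := {v | B v v = 2 ∧ v 0 = 0 ∧ v 6 = 0}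

/-- The positive part `Δ₀'⁺ = Δ₀' ∩ ℕ^I`. -/
def Δ0'Pos : Set Q := {v | v ∈ Δ0' ∧ ∀ i, 0 ≤ v i}

theorem CM_eq : CM = !![2, -1, 0, 0, 0, 0, 0, 0;
                        -1, 2, -1, 0, 0, 0, 0, 0;
                        0, -1, 2, -1, 0, 0, 0, 0;
                        0, 0, -1, 2, -1, 0, 0, -1;
                        0, 0, 0, -1, 2, -1, 0, 0;
                        0, 0, 0, 0, -1, 2, -1, 0;
                        0, 0, 0, 0, 0, -1, 2, 0;
                        0, 0, 0, -1, 0, 0, 0, 2] := by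
  funext i j
  fin_cases i <;> fin_cases j <;> rfl

theorem B_eq (v w : Q) : B v w =
    2 * (v 0 * w 0 + v 1 * w 1 + v 2 * w 2 + v 3 * w 3 + v 4 * w 4 + v 5 * w 5 + v 6 * w 6
      + v 7 * w 7)
    - (v 0 * w 1 + v 1 * w 0) - (v 1 * w 2 + v 2 * w 1) - (v 2 * w 3 + v 3 * w 2)
    - (v 3 * w 4 + v 4 * w 3) - (v 4 * w 5 + v 5 * w 4) - (v 5 * w 6 + v 6 * w 5)
    - (v 3 * w 7 + v 7 * w 3) := by
  rw [B, CM_eq]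
  simp [Fin.sum_univ_eight]
  ring

theorem B_add_self (v w : Q) : B (v + w) (v + w) = B v v + 2 * B v w + B w w := by
  simp only [B_eq, Pi.add_apply]
  ring

theorem B_sub_self (v w : Q) : B (v - w) (v - w) = B v v - 2 * B v w + B w w := by
  simp only [B_eq, Pi.sub_apply]
  ring

theorem B_sub_left (u v w : Q) : B (u - v) w = B u w - B v w := by
  simp only [B_eq, Pi.sub_apply]
  ring

theorem B_sub_right (u v w : Q) : B u (v - w) = B u v - B u w := by
  simp only [B_eq, Pi.sub_apply]
  ring

theorem B_comm (v w : Q) : B v w = B w v := by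
  simp only [B_eq]
  ring

theorem σmap_eq (v : Q) : σmap v = ![v 6, v 5, v 4, v 3, v 2, v 1, v 0, v 7] := by
  funext i
  fin_cases i <;> rfl

theorem σmap_sub (v w : Q) : σmap (v - w) = σmap v - σmap w := rfl

theorem B_σmap (v w : Q) : B (σmap v) (σmap w) = B v w := by
  simp [B_eq, σmap_eq]
  ring

theorem B_δ_left (v : Q) : B δ v = 0 := by
  simp [B_eq, δ]
  ring

/-- Completing squares along the diagram of type `E_7`. -/
theorem sixty_mul_B_self {v : Q} (h : v 0 = 0) : 60 * B v v =
    30 * (2 * v 7 - v 3) ^ 2 + 30 * (2 * v 1 - v 2) ^ 2 + 10 * (3 * v 2 - 2 * v 3) ^ 2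
      + 2 * (5 * v 3 - 6 * v 4) ^ 2 + 3 * (4 * v 4 - 5 * v 5) ^ 2 + 5 * (3 * v 5 - 4 * v 6) ^ 2
      + 40 * v 6 ^ 2 := by
  rw [B_eq, h]
  ring

theorem two_mul_sq_le_three_mul_B_self {v : Q} (h : v 0 = 0) : 2 * v 6 ^ 2 ≤ 3 * B v v := by
  have := sixty_mul_B_self h
  nlinarith [sq_nonneg (2 * v 7 - v 3), sq_nonneg (2 * v 1 - v 2), sq_nonneg (3 * v 2 - 2 * v 3),
    sq_nonneg (5 * v 3 - 6 * v 4), sq_nonneg (4 * v 4 - 5 * v 5), sq_nonneg (3 * v 5 - 4 * v 6)]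

theorem eq_zero_of_B_self_eq_zero {v : Q} (h : v 0 = 0) (hB : B v v = 0) : v = 0 := by
  have key := sixty_mul_B_self h
  rw [hB] at key
  have p7 := sq_nonneg (2 * v 7 - v 3)
  have p1 := sq_nonneg (2 * v 1 - v 2)
  have p2 := sq_nonneg (3 * v 2 - 2 * v 3)
  have p3 := sq_nonneg (5 * v 3 - 6 * v 4)
  have p4 := sq_nonneg (4 * v 4 - 5 * v 5)
  have p5 := sq_nonneg (3 * v 5 - 4 * v 6)
  have p6 := sq_nonneg (v 6)
  have e7 := pow_eq_zero_iff two_ne_zero |>.mp (show (2 * v 7 - v 3) ^ 2 = 0 by linarith)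
  have e1 := pow_eq_zero_iff two_ne_zero |>.mp (show (2 * v 1 - v 2) ^ 2 = 0 by linarith)
  have e2 := pow_eq_zero_iff two_ne_zero |>.mp (show (3 * v 2 - 2 * v 3) ^ 2 = 0 by linarith)
  have e3 := pow_eq_zero_iff two_ne_zero |>.mp (show (5 * v 3 - 6 * v 4) ^ 2 = 0 by linarith)
  have e4 := pow_eq_zero_iff two_ne_zero |>.mp (show (4 * v 4 - 5 * v 5) ^ 2 = 0 by linarith)
  have e5 := pow_eq_zero_iff two_ne_zero |>.mp (show (3 * v 5 - 4 * v 6) ^ 2 = 0 by linarith)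
  have e6 := pow_eq_zero_iff two_ne_zero |>.mp (show v 6 ^ 2 = 0 by linarith)
  funext i
  fin_cases i <;> simp <;> omega

/-- Roots of `Δ₀` with coordinate `1` at `6`. -/
def IsLevelOneRoot (v : Q) : Prop := B v v = 2 ∧ v 0 = 0 ∧ v 6 = 1

theorem IsLevelOneRoot.B_nonneg {v w : Q} (hv : IsLevelOneRoot v) (hw : IsLevelOneRoot w) :
    0 ≤ B v w := by
  obtain ⟨hv, hv0, hv6⟩ := hv
  obtain ⟨hw, hw0, hw6⟩ := hw
  have h := two_mul_sq_le_three_mul_B_self (v := v + w) (by simp [hv0, hw0])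
  rw [B_add_self, hv, hw, Pi.add_apply, hv6, hw6] at h
  omega

theorem IsLevelOneRoot.B_le_one {v w : Q} (hv : IsLevelOneRoot v) (hw : IsLevelOneRoot w)
    (hne : v ≠ w) : B v w ≤ 1 := by
  obtain ⟨hv, hv0, hv6⟩ := hv
  obtain ⟨hw, hw0, hw6⟩ := hw
  have h0 : (v - w) 0 = 0 := by simp [hv0, hw0]
  have h := two_mul_sq_le_three_mul_B_self h0
  have hpos : B (v - w) (v - w) ≠ 0 := fun h =>
    hne (sub_eq_zero.mp (eq_zero_of_B_self_eq_zero h0 h))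
  rw [B_sub_self, hv, hw] at h hpos
  have := sq_nonneg ((v - w) 6)
  omega

/-- If `γ + σ(γ) = δ` and `B(α, γ) = 1`, then `β = α - γ` satisfies
`α + σ(α) = δ + β + σ(β)` and `σ(β) ≠ β`. -/
theorem exists_of_B_eq_one {α γ : Q} (hα : IsLevelOneRoot α) (hγ : IsLevelOneRoot γ)
    (hδ : γ + σmap γ = δ) (h : B α γ = 1) :
    ∃ β ∈ Δ0', σmap β ≠ β ∧ α + σmap α = δ + β + σmap β := by
  refine ⟨α - γ, ⟨?_, ?_, ?_⟩, fun hfix => ?_, ?_⟩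
  · rw [B_sub_self, hα.1, hγ.1, h]
    norm_num
  · simp [hα.2.1, hγ.2.1]
  · simp [hα.2.2, hγ.2.2]
  · have h1 := B_σmap γ (α - γ)
    rw [hfix, eq_sub_of_add_eq' hδ, B_sub_left, B_δ_left, B_sub_right, B_comm γ α, h, hγ.1] at h1
    norm_num at h1
  · rw [σmap_sub, ← hδ]
    abel

theorem level_eq_zero_or_one {α : Q} (hα : α ∈ Δ0Pos) : α 6 = 0 ∨ α 6 = 1 := by
  obtain ⟨⟨hpos, hB⟩, h0⟩ := hα
  have h := two_mul_sq_le_three_mul_B_self h0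
  rw [hB] at h
  have := hpos 6
  have : α 6 < 2 := by nlinarith
  omega

theorem IsLevelOneRoot.dichotomy {α : Q} (hα : IsLevelOneRoot α) :
    (α + σmap α = δ) ∨ ∃ β ∈ Δ0', σmap β ≠ β ∧ α + σmap α = δ + β + σmap β := by
  obtain ⟨γ₁, h₁⟩ : ∃ γ : Q, γ = ![0, 0, 1, 2, 2, 2, 1, 1] := ⟨_, rfl⟩
  obtain ⟨γ₂, h₂⟩ : ∃ γ : Q, γ = ![0, 1, 1, 2, 2, 1, 1, 1] := ⟨_, rfl⟩
  obtain ⟨γ₃, h₃⟩ : ∃ γ : Q, γ = ![0, 1, 2, 2, 1, 1, 1, 1] := ⟨_, rfl⟩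
  have r₁ : IsLevelOneRoot γ₁ := by subst h₁; refine ⟨?_, ?_, ?_⟩ <;> decide
  have r₂ : IsLevelOneRoot γ₂ := by subst h₂; refine ⟨?_, ?_, ?_⟩ <;> decide
  have r₃ : IsLevelOneRoot γ₃ := by subst h₃; refine ⟨?_, ?_, ?_⟩ <;> decide
  have d₁ : γ₁ + σmap γ₁ = δ := by subst h₁; decide
  have d₂ : γ₂ + σmap γ₂ = δ := by subst h₂; decide
  have d₃ : γ₃ + σmap γ₃ = δ := by subst h₃; decide
  have hsum : B α γ₁ + B α γ₂ + B α γ₃ = 2 := by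
    subst h₁ h₂ h₃
    simp [B_eq, hα.2.1, hα.2.2]
    ring
  by_cases e₁ : α = γ₁
  · exact .inl (e₁ ▸ d₁)
  by_cases e₂ : α = γ₂
  · exact .inl (e₂ ▸ d₂)
  have n₁ := hα.B_nonneg r₁
  have n₂ := hα.B_nonneg r₂
  have l₁ := hα.B_le_one r₁ e₁
  have l₂ := hα.B_le_one r₂ e₂
  by_cases e₃ : α = γ₃
  · exact .inl (e₃ ▸ d₃)
  have l₃ := hα.B_le_one r₃ e₃
  rcases (by omega : B α γ₁ = 1 ∨ B α γ₂ = 1) with h | h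
  · exact .inr (exists_of_B_eq_one hα r₁ d₁ h)
  · exact .inr (exists_of_B_eq_one hα r₂ d₂ h)

theorem add_σmap_ne_zero {β : Q} (hβ : β ∈ Δ0') : β + σmap β ≠ 0 := by
  obtain ⟨hB, h0, h6⟩ := hβ
  intro h
  have c (i : Fin 8) := congrFun h i
  have c1 := c 1
  have c2 := c 2
  have c3 := c 3
  have c7 := c 7
  simp [σmap_eq] at c1 c2 c3 c7
  have e5 : β 5 = -β 1 := by omega
  have e4 : β 4 = -β 2 := by omega
  have e3 : β 3 = 0 := by omega
  have e7 : β 7 = 0 := by omega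
  rw [B_eq, h0, h6, e3, e4, e5, e7] at hB
  have : 4 * (β 1 * β 1 + β 2 * β 2 - β 1 * β 2) = 2 := by linarith
  omega

theorem statement7 : ∀ α ∈ Δ0Pos,
    ((α ∈ Δ0'Pos) ∨
      (∃ m : ℤ, 0 < m ∧ α + σmap α = m • δ) ∨
      (∃ β ∈ Δ0', σmap β ≠ β ∧ α + σmap α = δ + β + σmap β)) ∧
    ¬((α ∈ Δ0'Pos) ∧ (∃ m : ℤ, 0 < m ∧ α + σmap α = m • δ)) ∧
    ¬((α ∈ Δ0'Pos) ∧
      (∃ β ∈ Δ0', σmap β ≠ β ∧ α + σmap α = δ + β + σmap β)) ∧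
    ¬((∃ m : ℤ, 0 < m ∧ α + σmap α = m • δ) ∧
      (∃ β ∈ Δ0', σmap β ≠ β ∧ α + σmap α = δ + β + σmap β)) := by
  intro α hα
  have h0 := hα.2
  have level_of_b : (∃ m : ℤ, 0 < m ∧ α + σmap α = m • δ) → 0 < α 6 := by
    rintro ⟨m, hm, h⟩
    have := congrFun h 0
    simp [σmap_eq, δ, h0] at this
    omega
  have level_of_c : (∃ β ∈ Δ0', σmap β ≠ β ∧ α + σmap α = δ + β + σmap β) → α 6 = 1 := by
    rintro ⟨β, ⟨-, hβ0, hβ6⟩, -, h⟩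
    have := congrFun h 0
    simpa [σmap_eq, δ, h0, hβ0, hβ6, Matrix.vecHead] using this
  refine ⟨?_, ?_, ?_, ?_⟩
  · rcases level_eq_zero_or_one hα with h6 | h6
    · exact .inl ⟨⟨hα.1.2, h0, h6⟩, hα.1.1⟩
    · rcases IsLevelOneRoot.dichotomy ⟨hα.1.2, h0, h6⟩ with h | h
      · exact .inr (.inl ⟨1, one_pos, by rw [h, one_smul]⟩)
      · exact .inr (.inr h)
  · rintro ⟨ha, hb⟩
    exact (level_of_b hb).ne' ha.1.2.2
  · rintro ⟨ha, hc⟩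
    exact one_ne_zero ((level_of_c hc).symm.trans ha.1.2.2)
  · rintro ⟨⟨m, -, hm⟩, hc⟩
    have h6 := level_of_c hc
    obtain ⟨β, hβ, -, h⟩ := hc
    have m1 : m = 1 := by
      have := congrFun hm 0
      simp [σmap_eq, δ, h0, h6] at this
      exact this.symm
    rw [hm, m1, one_smul, add_assoc] at h
    exact add_σmap_ne_zero hβ (left_eq_add.mp h)

end Stmt7
end

section
/- For v \in \Delta^{re,+} let O(v) denote the sum of the distinct elements of the \sigma-orbit of v (so O(v) = v if \sigma(v) = v and O(v) = v + \sigma(v) otherwise). Define \underline{\Delta}_0^+ = \{O(\beta) : \beta \in \Delta_0'^+\} and \underline{\Delta}^{re,+} = \{x + m\delta : x \in \underline{\Delta}_0^+, m \in \mathbb{Z}_{\ge 0}\} \cup \{m\delta - x : x \in \underline{\Delta}_0^+, m \in \mathbb{Z}_{\ge 1}\}. Then: (i) for every v \in \Delta^{re,+}, either O(v) \in \mathbb{Z}_{>0}\cdot\delta or O(v) \in \underline{\Delta}^{re,+}; (ii) the assignment \omega \mapsto \sum_{u \in \omega} u defines a bijection from the set of \sigma-orbits \omega on \Delta^{re,+}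 whose element-sum does not lie in \mathbb{Z}\cdot\delta onto \underline{\Delta}^{re,+} (the positive real root system of affine type B_n^{(1)}). -/
/-!
Statement 9: For the affine root system of type `D_{2n}^{(1)}` (`n ≥ 2`) with the
admissible diagram automorphism `σ : α_i ↦ α_{2n-i}`, let `O(v)` be the sum of the
distinct elements of the `σ`-orbit of `v`, `ulΔ₀⁺ = O(Δ₀'⁺)`, and
`ulΔ^{re,+} = {x + mδ : x ∈ ulΔ₀⁺, m ≥ 0} ∪ {mδ - x : x ∈ ulΔ₀⁺, m ≥ 1}`.
Then (i) for every positive real root `v`, either `O(v) ∈ ℤ_{>0}·δ` or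
`O(v) ∈ ulΔ^{re,+}`; (ii) `ω ↦ ∑_{u ∈ ω} u` is a bijection from the set of
`σ`-orbits on `Δ^{re,+}` whose element-sum is not in `ℤ·δ` onto `ulΔ^{re,+}`
(the positive real roots of type `B_n^{(1)}`).
-/

namespace Stmt9

/-- The root lattice `Q = ⨁_{i ∈ I} ℤ α_i` for `I = {0,1,…,2n}`. -/
abbrev Q (n : ℕ) := Fin (2 * n + 1) → ℤ

/-- The edges of the Dynkin diagram of affine type `D_{2n}^{(1)}`. -/
abbrev edge (n i j : ℕ) : Prop :=
  (i + 1 = j ∧ 2 ≤ i ∧ j ≤ 2 * n - 1) ∨ (j + 1 = i ∧ 2 ≤ j ∧ i ≤ 2 * n - 1) ∨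
  (i = 0 ∧ j = 2) ∨ (i = 2 ∧ j = 0) ∨ (i = 1 ∧ j = 2) ∨ (i = 2 ∧ j = 1) ∨
  (i = 2 * n - 2 ∧ j = 2 * n) ∨ (i = 2 * n ∧ j = 2 * n - 2)

/-- The generalized Cartan matrix of type `D_{2n}^{(1)}`. -/
def CM (n : ℕ) (i j : Fin (2 * n + 1)) : ℤ :=
  if i = j then 2 else if edge n (i : ℕ) (j : ℕ) then -1 else 0

/-- The symmetric bilinear form `B` on `Q` determined by the Cartan matrix. -/
def B (n : ℕ) (v w : Q n) : ℤ := ∑ i, ∑ j, v i * CM n i j * w j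

/-- The set of positive real roots. -/
def ΔrePos (n : ℕ) : Set (Q n) := {v | (∀ i, 0 ≤ v i) ∧ B n v v = 2}

/-- The primitive null root `δ`. -/
def δ (n : ℕ) : Q n := fun i =>
  if (i : ℕ) = 0 ∨ (i : ℕ) = 1 ∨ (i : ℕ) = 2 * n - 1 ∨ (i : ℕ) = 2 * n then 1 else 2

/-- The admissible diagram automorphism `σ : α_i ↦ α_{2n-i}` (on coordinates). -/
def σmap (n : ℕ) (v : Q n) : Q n := fun i => v ⟨2 * n - (i : ℕ), by omega⟩

/-- The `σ`-stable subsystem `Δ₀'` of type `A_{2n-1}` supported on `I ∖ {0, 2n}`. -/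
def Δ0' (n : ℕ) : Set (Q n) :=
  {v | B n v v = 2 ∧ v 0 = 0 ∧ v ⟨2 * n, by omega⟩ = 0}

/-- The positive part `Δ₀'⁺ = Δ₀' ∩ ℕ^I`. -/
def Δ0'Pos (n : ℕ) : Set (Q n) := {v | v ∈ Δ0' n ∧ ∀ i, 0 ≤ v i}

/-- `O(v)`: the sum of the distinct elements of the `σ`-orbit of `v`
(here `σ` has order 2, so `O(v) = v` if `σ(v) = v` and `O(v) = v + σ(v)` otherwise). -/
noncomputable def O (n : ℕ) (v : Q n) : Q n :=
  if σmap n v = v then v else v + σmap n v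

/-- `ulΔ₀⁺ = {O(β) : β ∈ Δ₀'⁺}` (a positive system of type `B_n`). -/
noncomputable def ulΔ0Pos (n : ℕ) : Set (Q n) := O n '' Δ0'Pos n

/-- `ulΔ^{re,+} = {x + mδ : x ∈ ulΔ₀⁺, m ∈ ℤ_{≥0}} ∪ {mδ - x : x ∈ ulΔ₀⁺, m ∈ ℤ_{≥1}}`,
the positive real roots of affine type `B_n^{(1)}`. -/
noncomputable def ulΔrePos (n : ℕ) : Set (Q n) :=
  {y | ∃ x ∈ ulΔ0Pos n, ∃ m : ℕ, y = x + (m : ℤ) • δ n} ∪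
  {y | ∃ x ∈ ulΔ0Pos n, ∃ m : ℕ, 1 ≤ m ∧ y = (m : ℤ) • δ n - x}

/-- The `σ`-orbit of `v`. -/
def orb (n : ℕ) (v : Q n) : Set (Q n) := {w | ∃ k : ℕ, w = (σmap n)^[k] v}

/-- The set of `σ`-orbits on `Δ^{re,+}`. -/
def Orbits (n : ℕ) : Set (Set (Q n)) := {ω | ∃ v ∈ ΔrePos n, ω = orb n v}

section

variable {n : ℕ}

/-- The coordinates of the finite part of a vector in the orthonormal basis `ε_1, …, ε_{2n}`, where
`α_i = ε_i - ε_{i+1}` for `0 < i < 2n`, `α_{2n} = ε_{2n-1} + ε_{2n}` and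
`α_0 = δ - ε_1 - ε_2`. -/
def epsCoord (n : ℕ) : Q n →ₗ[ℤ] (Fin (2 * n) → ℤ) where
  toFun v k := v k.succ - v k.castSucc - (if (k : ℕ) = 1 then v 0 else 0) +
    (if (k : ℕ) + 2 = 2 * n then v (Fin.last _) else 0)
  map_add' v w := by
    ext k
    simp only [Pi.add_apply]
    split_ifs <;> ring
  map_smul' c v := by
    ext k
    simp only [Pi.smul_apply, smul_eq_mul, RingHom.id_apply]
    split_ifs <;> ring

lemma epsCoord_apply (v : Q n) (k : Fin (2 * n)) :
    epsCoord n v k = v k.succ - v k.castSucc - (if (k : ℕ) = 1 then v 0 else 0) +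
      (if (k : ℕ) + 2 = 2 * n then v (Fin.last _) else 0) := rfl

lemma epsCoord_single_zero (hn : 2 ≤ n) :
    epsCoord n (Pi.single 0 1) =
      -Pi.single ⟨0, by omega⟩ 1 - Pi.single ⟨1, by omega⟩ 1 := by
  ext k
  simp only [epsCoord_apply, Pi.single_apply, Fin.ext_iff, Fin.val_succ, Fin.val_castSucc,
    Fin.val_zero, Fin.val_last, Pi.sub_apply, Pi.neg_apply]
  grind

lemma epsCoord_single_last (hn : 2 ≤ n) :
    epsCoord n (Pi.single (Fin.last _) 1) =
      Pi.single ⟨2 * n - 1, by omega⟩ 1 + Pi.single ⟨2 * n - 2, by omega⟩ 1 := by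
  ext k
  simp only [epsCoord_apply, Pi.single_apply, Fin.ext_iff, Fin.val_succ, Fin.val_castSucc,
    Fin.val_zero, Fin.val_last, Pi.add_apply]
  have := k.2
  grind

lemma epsCoord_single_mid {i : Fin (2 * n + 1)} (h0 : (i : ℕ) ≠ 0) (h1 : (i : ℕ) ≠ 2 * n) :
    epsCoord n (Pi.single i 1) =
      Pi.single ⟨i - 1, by omega⟩ 1 - Pi.single ⟨i, by omega⟩ 1 := by
  ext k
  simp only [epsCoord_apply, Pi.single_apply, Fin.ext_iff, Fin.val_succ, Fin.val_castSucc,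
    Fin.val_zero, Fin.val_last, Pi.sub_apply]
  grind

lemma CM_eq_dotProduct (hn : 2 ≤ n) (i j : Fin (2 * n + 1)) :
    CM n i j = epsCoord n (Pi.single i 1) ⬝ᵥ epsCoord n (Pi.single j 1) := by
  have hcases : ∀ i : Fin (2 * n + 1),
      i = 0 ∨ i = Fin.last _ ∨ ((i : ℕ) ≠ 0 ∧ (i : ℕ) ≠ 2 * n) := by
    intro i
    simp only [Fin.ext_iff, Fin.val_zero, Fin.val_last]
    omega
  have hi := i.2
  have hj := j.2
  rcases hcases i with rfl | rfl | ⟨hi0, hi1⟩ <;> rcases hcases j with rfl | rfl | ⟨hj0, hj1⟩ <;>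
    simp only [epsCoord_single_zero hn, epsCoord_single_last hn, epsCoord_single_mid, ne_eq,
      not_false_eq_true, *, dotProduct_add, dotProduct_sub, dotProduct_neg, dotProduct_single,
      Pi.add_apply, Pi.sub_apply, Pi.neg_apply, Pi.single_apply, CM, edge, Fin.ext_iff,
      Fin.val_zero, Fin.val_last, mul_one] <;> grind

lemma epsCoord_eq_sum (v : Q n) (k : Fin (2 * n)) :
    epsCoord n v k = ∑ i, v i * epsCoord n (Pi.single i 1) k := by
  conv_lhs => rw [← Finset.univ_sum_single v]
  simp only [map_sum, Finset.sum_apply]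
  refine Finset.sum_congr rfl fun i _ => ?_
  have h : Pi.single i (v i) = v i • (Pi.single i 1 : Q n) := by
    rw [← Pi.single_smul, smul_eq_mul, mul_one]
  rw [h, map_smul, Pi.smul_apply, smul_eq_mul]

lemma B_eq_dotProduct (hn : 2 ≤ n) (v w : Q n) : B n v w = epsCoord n v ⬝ᵥ epsCoord n w := by
  simp only [B, dotProduct, epsCoord_eq_sum v, epsCoord_eq_sum w, CM_eq_dotProduct hn,
    Finset.mul_sum, Finset.sum_mul]
  rw [Finset.sum_comm]
  conv_rhs => rw [Finset.sum_comm]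
  refine Finset.sum_congr rfl fun i _ => ?_
  conv_rhs => rw [Finset.sum_comm]
  refine Finset.sum_congr rfl fun j _ => Finset.sum_congr rfl fun k _ => ?_
  ring

lemma sum_epsCoord (hn : 2 ≤ n) (v : Q n) :
    ∑ k, epsCoord n v k = 2 * (v (Fin.last _) - v 0) := by
  have h := (Fin.sum_univ_castSucc v).symm.trans (Fin.sum_univ_succ v)
  have h1 : ∀ k : Fin (2 * n), ((k : ℕ) = 1) ↔ k = ⟨1, by omega⟩ := fun k => by
    simp [Fin.ext_iff]
  have h2 : ∀ k : Fin (2 * n), ((k : ℕ) + 2 = 2 * n) ↔ k = ⟨2 * n - 2, by omega⟩ := fun k => by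
    simp only [Fin.ext_iff]; omega
  simp only [epsCoord_apply, Finset.sum_add_distrib, Finset.sum_sub_distrib, h1, h2,
    Finset.sum_ite_eq', Finset.mem_univ, if_true]
  linarith

lemma epsCoord_σmap (v : Q n) (k : Fin (2 * n)) :
    epsCoord n (σmap n v) k = -epsCoord n v k.rev := by
  have e1 : σmap n v k.succ = v k.rev.castSucc := by
    unfold σmap; congr 1
  have e2 : σmap n v k.castSucc = v k.rev.succ := by
    unfold σmap; congr 1; ext; simp [Fin.val_rev]; omega
  have e3 : σmap n v 0 = v (Fin.last _) := by
    unfold σmap; congr 1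
  have e4 : σmap n v (Fin.last _) = v 0 := by
    unfold σmap; congr 1; ext; simp
  simp only [epsCoord_apply, e1, e2, e3, e4, Fin.val_rev]
  have := k.2
  grind

lemma epsCoord_δ (hn : 2 ≤ n) : epsCoord n (δ n) = 0 := by
  ext k
  simp only [epsCoord_apply, δ, Fin.val_succ, Fin.val_castSucc, Fin.val_zero, Fin.val_last,
    Pi.zero_apply]
  have := k.2
  grind

lemma δ_zero : δ n 0 = 1 := by simp [δ]

lemma δ_last : δ n (Fin.last _) = 1 := by simp [δ]

lemma δ_pos (i : Fin (2 * n + 1)) : 0 < δ n i := by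
  unfold δ; split_ifs <;> norm_num

lemma eq_smul_δ_of_epsCoord_eq_zero (hn : 2 ≤ n) {v : Q n} (h : epsCoord n v = 0) :
    v = v 0 • δ n := by
  have hl : v (Fin.last _) = v 0 := by
    have := sum_epsCoord hn v
    simp only [h, Pi.zero_apply, Finset.sum_const_zero] at this
    omega
  have hk : ∀ k (hk : k < 2 * n), v ⟨k + 1, by omega⟩ - v ⟨k, by omega⟩ -
      (if k = 1 then v 0 else 0) + (if k + 2 = 2 * n then v 0 else 0) = 0 := by
    intro k hk
    have := congrFun h ⟨k, hk⟩
    rw [epsCoord_apply, hl] at this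
    exact this
  have h1 : v ⟨1, by omega⟩ = v 0 := by
    have h' := hk 0 (by omega)
    rw [if_neg (by omega), if_neg (by omega)] at h'
    have : v ⟨0, by omega⟩ = v 0 := rfl
    simp only [zero_add] at h'
    linarith
  have hmid : ∀ k, 2 ≤ k → ∀ hk : k ≤ 2 * n - 2, v ⟨k, by omega⟩ = 2 * v 0 := by
    intro k hk2
    induction k, hk2 using Nat.le_induction with
    | base =>
      intro _
      have := hk 1 (by omega)
      rw [if_pos rfl, if_neg (by omega), h1] at this
      linarith
    | succ k hk2 ih =>
      intro hle
      have := hk k (by omega)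
      rw [if_neg (by omega), if_neg (by omega), ih (by omega)] at this
      linarith
  have hp : v ⟨2 * n - 1, by omega⟩ = v 0 := by
    have := hk (2 * n - 1) (by omega)
    rw [if_neg (by omega), if_neg (by omega)] at this
    have e : v ⟨2 * n - 1 + 1, by omega⟩ = v 0 := by
      rw [← hl]; congr 1; ext; simp; omega
    linarith
  ext ⟨i, hi⟩
  simp only [Pi.smul_apply, δ, smul_eq_mul]
  split_ifs with hc
  · rcases hc with rfl | rfl | rfl | rfl
    · simp
    · linarith
    · linarith
    · rw [mul_one]; exact hl
  · rw [hmid i (by omega) (by omega)]; ring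

lemma exists_epsCoord_eq (hn : 2 ≤ n) {d : Fin (2 * n) → ℤ} (hd : Even (∑ k, d k)) :
    ∃ v : Q n, epsCoord n v = d := by
  obtain ⟨c, hc⟩ := hd
  let f : ℕ → ℤ := fun k => if h : k < 2 * n then d ⟨k, h⟩ else 0
  have hf : ∀ k : Fin (2 * n), f k = d k := fun k => by simp [f]
  have hs : ∑ k ∈ Finset.range (2 * n), f k = c + c := by
    rw [Finset.sum_range, ← hc]; exact Finset.sum_congr rfl fun k _ => hf k
  refine ⟨fun i => if (i : ℕ) = 2 * n then c else if (i : ℕ) = 2 * n - 1 then c - f (2 * n - 1)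
    else ∑ k ∈ Finset.range i, f k, ?_⟩
  ext k
  obtain ⟨m, rfl⟩ : ∃ m, n = m + 2 := ⟨n - 2, by omega⟩
  have hs' : ∑ k ∈ Finset.range (2 * m + 2), f k + f (2 * m + 2) + f (2 * m + 3) = c + c := by
    rw [← hs, show 2 * (m + 2) = (2 * m + 2) + 1 + 1 by ring, Finset.sum_range_succ f (2 * m + 3),
      Finset.sum_range_succ f (2 * m + 2)]
  rw [← hf, epsCoord_apply]
  have hk := k.2
  have hr := Finset.sum_range_succ f k
  simp only [Fin.val_succ, Fin.val_castSucc, Fin.val_zero, Fin.val_last, Finset.range_zero,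
    Finset.sum_empty, show 2 * (m + 2) - 1 = 2 * m + 3 by omega]
  generalize (k : ℕ) = j at *
  rcases (by omega : j = 2 * m + 3 ∨ j = 2 * m + 2 ∨ j < 2 * m + 2) with rfl | rfl | hj
  · grind
  · grind
  · grind

lemma eq_add_smul_δ_of_epsCoord_eq (hn : 2 ≤ n) {v w : Q n} (h : epsCoord n v = epsCoord n w) :
    v = w + (v 0 - w 0) • δ n := by
  have := eq_smul_δ_of_epsCoord_eq_zero hn (v := v - w) (by rw [map_sub, h, sub_self])
  rw [Pi.sub_apply] at this
  rw [← this]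
  abel

lemma B_self_nonneg (hn : 2 ≤ n) (v : Q n) : 0 ≤ B n v v := by
  rw [B_eq_dotProduct hn]
  exact Finset.sum_nonneg fun k _ => mul_self_nonneg _

lemma even_B_self (hn : 2 ≤ n) (v : Q n) : Even (B n v v) := by
  have h1 : Even (∑ k, (epsCoord n v k * epsCoord n v k - epsCoord n v k)) :=
    Finset.even_sum _ fun k _ => by
      rw [← mul_sub_one]; exact Int.even_mul_pred_self _
  rw [Finset.sum_sub_distrib, sum_epsCoord hn] at h1
  rw [B_eq_dotProduct hn, dotProduct]
  exact (Int.even_sub.1 h1).2 (even_two_mul _)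

lemma eq_smul_δ_of_B_self_eq_zero (hn : 2 ≤ n) {v : Q n} (h : B n v v = 0) : v = v 0 • δ n := by
  rw [B_eq_dotProduct hn, dotProduct_self_eq_zero] at h
  exact eq_smul_δ_of_epsCoord_eq_zero hn h

lemma B_nonpos_of_disjoint {p q : Q n} (hp : 0 ≤ p) (hq : 0 ≤ q) (h : ∀ i, p i * q i = 0) :
    B n p q ≤ 0 := by
  refine Finset.sum_nonpos fun i _ => Finset.sum_nonpos fun j _ => ?_
  by_cases hij : i = j
  · subst hij
    rw [mul_right_comm, h, zero_mul]
  · have hc : CM n i j ≤ 0 := by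
      rw [CM, if_neg hij]
      split_ifs <;> norm_num
    exact mul_nonpos_of_nonpos_of_nonneg (mul_nonpos_of_nonneg_of_nonpos (hp i) hc) (hq j)

lemma nonneg_or_nonpos_of_B_self_eq_two (hn : 2 ≤ n) {v : Q n} (h : B n v v = 2) :
    0 ≤ v ∨ v ≤ 0 := by
  let p : Q n := fun i => max (v i) 0
  let q : Q n := fun i => max (-v i) 0
  have hv : v = p - q := by
    ext i
    simp only [p, q, Pi.sub_apply]
    omega
  have hpq : B n p q ≤ 0 := by
    refine B_nonpos_of_disjoint (fun i => le_max_right _ _) (fun i => le_max_right _ _) fun i => ?_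
    simp only [p, q]
    rcases le_total (v i) 0 with hi | hi
    · rw [max_eq_right hi, zero_mul]
    · rw [max_eq_right (neg_nonpos.2 hi), mul_zero]
  have hB : B n v v = B n p p + B n q q - 2 * B n p q := by
    simp only [B_eq_dotProduct hn]
    conv_lhs => rw [hv]
    rw [map_sub, sub_dotProduct, dotProduct_sub, dotProduct_sub,
      dotProduct_comm (epsCoord n q) (epsCoord n p)]
    ring
  have hz : B n p p = 0 ∨ B n q q = 0 := by
    obtain ⟨a, ha⟩ := even_B_self hn p
    obtain ⟨b, hb⟩ := even_B_self hn q
    have := B_self_nonneg hn p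
    have := B_self_nonneg hn q
    omega
  have hpos : ∀ {u : Q n}, 0 ≤ u → B n u u = 0 → u = 0 ∨ ∀ i, 0 < u i := by
    intro u hu h0
    have he := eq_smul_δ_of_B_self_eq_zero hn h0
    rcases (hu 0).eq_or_lt with h1 | h1
    · left
      rw [he, ← h1, Pi.zero_apply, zero_smul]
    · right
      intro i
      rw [he]
      exact mul_pos h1 (δ_pos i)
  rcases hz with hz | hz
  · rcases hpos (fun i => le_max_right _ _) hz with h0 | h0
    · right; intro i
      have := congrFun h0 i
      simp only [Pi.zero_apply] at this ⊢
      omega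
    · left; intro i
      have := h0 i
      simp only [Pi.zero_apply] at this ⊢
      omega
  · rcases hpos (fun i => le_max_right _ _) hz with h0 | h0
    · left; intro i
      have := congrFun h0 i
      simp only [Pi.zero_apply] at this ⊢
      omega
    · right; intro i
      have := h0 i
      simp only [Pi.zero_apply] at this ⊢
      omega

lemma exists_eq_single_add_single {ι : Type*} [Fintype ι] [DecidableEq ι] {d : ι → ℤ}
    (h : d ⬝ᵥ d = 2) :
    ∃ i j s t, i ≠ j ∧ (s = 1 ∨ s = -1) ∧ (t = 1 ∨ t = -1) ∧ d = Pi.single i s + Pi.single j t := by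
  have hle : ∀ S : Finset ι, ∑ k ∈ S, d k * d k ≤ 2 := fun S =>
    (Finset.sum_le_univ_sum_of_nonneg fun k => mul_self_nonneg (d k)).trans_eq h
  have hunit : ∀ k, d k ≠ 0 → d k = 1 ∨ d k = -1 := by
    intro k hk
    have := hle {k}
    rw [Finset.sum_singleton] at this
    have h1 : d k < 2 := by nlinarith
    have h2 : -2 < d k := by nlinarith
    omega
  obtain ⟨i, hi⟩ : ∃ i, d i ≠ 0 := by
    by_contra! hc
    simp [dotProduct, hc] at h
  obtain ⟨j, hij, hj⟩ : ∃ j, i ≠ j ∧ d j ≠ 0 := by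
    by_contra! hc
    rw [dotProduct, Finset.sum_eq_single i (fun k _ hk => by rw [hc k hk.symm, zero_mul])
      (by simp)] at h
    rcases hunit i hi with h1 | h1 <;> rw [h1] at h <;> norm_num at h
  refine ⟨i, j, d i, d j, hij, hunit i hi, hunit j hj, ?_⟩
  ext k
  rw [Pi.add_apply]
  by_cases hki : k = i
  · subst hki
    simp [hij]
  by_cases hkj : k = j
  · subst hkj
    simp [hki]
  rw [Pi.single_eq_of_ne hki, Pi.single_eq_of_ne hkj, add_zero]
  by_contra hk
  have := hle {i, j, k}
  rw [Finset.sum_insert (by simp [hij, Ne.symm hki]), Finset.sum_pair (Ne.symm hkj)] at this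
  have hsq : ∀ k, d k ≠ 0 → d k * d k = 1 := fun k hk => by
    rcases hunit k hk with h1 | h1 <;> rw [h1] <;> norm_num
  rw [hsq i hi, hsq j hj, hsq k hk] at this
  norm_num at this

lemma σmap_zero_apply (v : Q n) : σmap n v 0 = v (Fin.last _) := by
  unfold σmap; congr 1

lemma σmap_σmap (v : Q n) : σmap n (σmap n v) = v := by
  ext i
  unfold σmap; congr 1; ext; simp only; omega

lemma σmap_add (v w : Q n) : σmap n (v + w) = σmap n v + σmap n w := rfl

lemma σmap_neg (v : Q n) : σmap n (-v) = -σmap n v := rfl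

lemma σmap_smul (c : ℤ) (v : Q n) : σmap n (c • v) = c • σmap n v := rfl

lemma σmap_δ (hn : 2 ≤ n) : σmap n (δ n) = δ n := by
  ext i
  have := i.2
  unfold σmap δ
  grind

lemma B_σmap (hn : 2 ≤ n) (v : Q n) : B n (σmap n v) (σmap n v) = B n v v := by
  simp only [B_eq_dotProduct hn, dotProduct, epsCoord_σmap, neg_mul_neg]
  exact Equiv.sum_comp Fin.revPerm fun k => epsCoord n v k * epsCoord n v k

lemma epsCoord_add_smul_δ (hn : 2 ≤ n) (v : Q n) (c : ℤ) :
    epsCoord n (v + c • δ n) = epsCoord n v := by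
  rw [map_add, map_smul, epsCoord_δ hn, smul_zero, add_zero]

lemma B_add_smul_δ (hn : 2 ≤ n) (v : Q n) (c : ℤ) :
    B n (v + c • δ n) (v + c • δ n) = B n v v := by
  simp only [B_eq_dotProduct hn, epsCoord_add_smul_δ hn]

lemma σmap_add_smul_δ (hn : 2 ≤ n) (v : Q n) (c : ℤ) :
    σmap n (v + c • δ n) = σmap n v + c • δ n := by
  rw [σmap_add, σmap_smul, σmap_δ hn]

lemma O_of_eq {v : Q n} (h : σmap n v = v) : O n v = v := if_pos h

lemma O_of_ne {v : Q n} (h : σmap n v ≠ v) : O n v = v + σmap n v := if_neg h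

/-- The real roots `±ε_i ± ε_j + mδ` with `j ≠ 2n + 1 - i`, whose orbit sum is a long root of
`B_n^{(1)}`. -/
def IsLong (v : Q n) : Prop :=
  ∃ i j : Fin (2 * n), ∃ s t : ℤ, i ≠ j ∧ j ≠ i.rev ∧ (s = 1 ∨ s = -1) ∧ (t = 1 ∨ t = -1) ∧
    epsCoord n v = Pi.single i s + Pi.single j t

lemma rev_ne_self (i : Fin (2 * n)) : i.rev ≠ i := by
  simp only [ne_eq, Fin.ext_iff, Fin.val_rev]
  omega

namespace IsLong

variable {v w : Q n}

lemma add_smul_δ (hn : 2 ≤ n) (h : IsLong v) (c : ℤ) : IsLong (v + c • δ n) := by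
  unfold IsLong
  rwa [epsCoord_add_smul_δ hn]

lemma epsCoord_rev_eq_zero (h : IsLong v) {k : Fin (2 * n)} (hk : epsCoord n v k ≠ 0) :
    epsCoord n v k.rev = 0 := by
  obtain ⟨i, j, s, t, hij, hji, -, -, hd⟩ := h
  have hi := rev_ne_self i
  have hj := rev_ne_self j
  have hr : i ≠ j.rev := fun h => hji (by rw [h, Fin.rev_rev])
  rw [hd] at hk ⊢
  simp only [Pi.add_apply, Pi.single_apply] at hk ⊢
  grind

lemma B_σmap_eq_zero (hn : 2 ≤ n) (h : IsLong v) : B n v (σmap n v) = 0 := by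
  rw [B_eq_dotProduct hn]
  refine Finset.sum_eq_zero fun k _ => ?_
  by_cases hk : epsCoord n v k = 0
  · rw [hk, zero_mul]
  · rw [epsCoord_σmap, h.epsCoord_rev_eq_zero hk, neg_zero, mul_zero]

lemma B_self (hn : 2 ≤ n) (h : IsLong v) : B n v v = 2 := by
  obtain ⟨i, j, s, t, hij, -, hs, ht, hd⟩ := h
  rw [B_eq_dotProduct hn, hd, add_dotProduct, single_dotProduct, single_dotProduct]
  simp only [Pi.add_apply, Pi.single_eq_same, Pi.single_eq_of_ne hij, Pi.single_eq_of_ne hij.symm]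
  rcases hs with rfl | rfl <;> rcases ht with rfl | rfl <;> norm_num

lemma σmap_ne (hn : 2 ≤ n) (h : IsLong v) : σmap n v ≠ v := by
  intro he
  have h1 := h.B_σmap_eq_zero hn
  rw [he, h.B_self hn] at h1
  norm_num at h1

lemma B_O_self (hn : 2 ≤ n) (h : IsLong v) : B n (v + σmap n v) (v + σmap n v) = 4 := by
  have h1 := h.B_σmap_eq_zero hn
  have h2 := h.B_self hn
  have h3 := B_σmap hn v
  rw [B_eq_dotProduct hn] at *
  rw [map_add, add_dotProduct, dotProduct_add, dotProduct_add,
    dotProduct_comm (epsCoord n (σmap n v)) (epsCoord n v)]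
  rw [B_eq_dotProduct hn] at h3
  linarith

lemma last_sub_zero (hn : 2 ≤ n) (h : IsLong v) :
    -1 ≤ v (Fin.last _) - v 0 ∧ v (Fin.last _) - v 0 ≤ 1 := by
  obtain ⟨i, j, s, t, -, -, hs, ht, hd⟩ := h
  have := sum_epsCoord hn v
  simp only [hd, Pi.add_apply, Finset.sum_add_distrib, Finset.sum_pi_single', Finset.mem_univ,
    if_true] at this
  omega

/-- Replacing `±ε_j` by `∓ε_{2n+1-j}` in a long root shifts its orbit sum by an odd multiple of
`δ`. -/
lemma exists_odd_shift (hn : 2 ≤ n) (h : IsLong v) :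
    ∃ w : Q n, IsLong w ∧ Odd (w (Fin.last _) - w 0 - (v (Fin.last _) - v 0)) ∧
      ∃ c : ℤ, Odd c ∧ w + σmap n w = v + σmap n v + c • δ n := by
  obtain ⟨i, j, s, t, hij, hji, hs, ht, hd⟩ := h
  have hr : i ≠ j.rev := fun h => hji (by rw [h, Fin.rev_rev])
  obtain ⟨w, hw⟩ := exists_epsCoord_eq hn (d := Pi.single i s + Pi.single j.rev (-t)) (by
    simp only [Pi.add_apply, Finset.sum_add_distrib, Finset.sum_pi_single', Finset.mem_univ,
      if_true]
    rcases hs with rfl | rfl <;> rcases ht with rfl | rfl <;> decide)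
  have hsum : w (Fin.last _) - w 0 - (v (Fin.last _) - v 0) = -t := by
    have h1 := sum_epsCoord hn v
    have h2 := sum_epsCoord hn w
    simp only [hd, hw, Pi.add_apply, Finset.sum_add_distrib, Finset.sum_pi_single',
      Finset.mem_univ, if_true] at h1 h2
    linarith
  have he : epsCoord n (w + σmap n w) = epsCoord n (v + σmap n v) := by
    ext k
    simp only [map_add, Pi.add_apply, epsCoord_σmap, hd, hw, Pi.single_apply, Fin.rev_eq_iff]
    have : k = j.rev ↔ k.rev = j := by rw [Fin.rev_eq_iff]
    grind
  have hodd : Odd (-t) := by rcases ht with rfl | rfl <;> decide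
  refine ⟨w, ⟨i, j.rev, s, -t, hr, fun h => hij (Fin.rev_inj.1 h).symm, hs, by omega, hw⟩,
    hsum ▸ hodd, _, ?_, eq_add_smul_δ_of_epsCoord_eq hn he⟩
  simp only [Pi.add_apply, σmap_zero_apply]
  obtain ⟨a, ha⟩ := hodd
  exact ⟨a + w 0 - v 0, by linarith⟩

protected lemma σmap (h : IsLong v) : IsLong (σmap n v) := by
  obtain ⟨i, j, s, t, hij, hji, hs, ht, hd⟩ := h
  refine ⟨i.rev, j.rev, -s, -t, fun h => hij (Fin.rev_inj.1 h), fun h => hji (Fin.rev_inj.1 h),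
    by omega, by omega, ?_⟩
  ext k
  simp only [epsCoord_σmap, hd, Pi.add_apply, Pi.single_apply, Fin.rev_eq_iff]
  grind

end IsLong

lemma eq_of_add_σmap_eq (hn : 2 ≤ n) {v w : Q n} {i j j' : Fin (2 * n)} {s t s' t' : ℤ}
    (hij : i ≠ j) (hji : j ≠ i.rev) (hij' : i ≠ j') (hji' : j' ≠ i.rev)
    (ht : t = 1 ∨ t = -1)
    (hv : epsCoord n v = Pi.single i s + Pi.single j t)
    (hw : epsCoord n w = Pi.single i s' + Pi.single j' t')
    (h : v + σmap n v = w + σmap n w) : v = w := by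
  have hT : ∀ k, epsCoord n v k - epsCoord n v k.rev = epsCoord n w k - epsCoord n w k.rev := by
    intro k
    have := congrFun (congrArg (epsCoord n) h) k
    simpa only [map_add, Pi.add_apply, epsCoord_σmap, ← sub_eq_add_neg] using this
  have h0 : v 0 + v (Fin.last _) = w 0 + w (Fin.last _) := by
    simpa only [Pi.add_apply, σmap_zero_apply] using congrFun h 0
  have hi := rev_ne_self i
  have hj := rev_ne_self j
  have hir : i ≠ j.rev := fun h => hji (by rw [h, Fin.rev_rev])
  have hs : s = s' := by
    have := hT i
    simp only [hv, hw, Pi.add_apply, Pi.single_apply] at this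
    grind
  have ht' : (j' = j ∧ t' = t) ∨ t' = -t := by
    have := hT j
    simp only [hv, hw, Pi.add_apply, Pi.single_apply] at this
    grind
  rcases ht' with ⟨rfl, rfl⟩ | rfl
  · have := eq_add_smul_δ_of_epsCoord_eq hn (hv.trans (by rw [hs, ← hw]) : _ = epsCoord n w)
    have hl := congrFun this (Fin.last _)
    simp only [Pi.add_apply, Pi.smul_apply, δ_last, smul_eq_mul, mul_one] at hl
    rw [this, show v 0 - w 0 = 0 by linarith, zero_smul, add_zero]
  · have h1 := sum_epsCoord hn v
    have h2 := sum_epsCoord hn w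
    simp only [hv, hw, Pi.add_apply, Finset.sum_add_distrib, Finset.sum_pi_single',
      Finset.mem_univ, if_true] at h1 h2
    omega

lemma IsLong.eq_or_eq_σmap (hn : 2 ≤ n) {v w : Q n} (hv : IsLong v) (hw : IsLong w)
    (h : v + σmap n v = w + σmap n w) : v = w ∨ v = σmap n w := by
  have hw' := hw.σmap
  obtain ⟨i, j, s, t, hij, hji, hs, ht, hd⟩ := hv
  have key : ∀ u : Q n, IsLong u → v + σmap n v = u + σmap n u →
      epsCoord n u i ≠ 0 → v = u := by
    rintro u ⟨a, b, p, q, hab, hba, hp, hq, hu⟩ he hne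
    by_cases hia : i = a
    · subst hia
      exact eq_of_add_σmap_eq hn hij hji hab hba ht hd hu he
    · by_cases hib : i = b
      · subst hib
        exact eq_of_add_σmap_eq hn hij hji (Ne.symm hab)
          (fun h => hba (by rw [h, Fin.rev_rev])) ht hd (hu.trans (add_comm _ _)) he
      · rw [hu, Pi.add_apply, Pi.single_eq_of_ne hia, Pi.single_eq_of_ne hib, add_zero] at hne
        exact absurd rfl hne
  by_cases h0 : epsCoord n w i = 0
  · right
    refine key _ hw' (by rw [h, σmap_σmap, add_comm]) ?_
    have := congrFun (congrArg (epsCoord n) h) i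
    have hi := rev_ne_self i
    have hij' : i.rev ≠ j := Ne.symm hji
    simp only [map_add, Pi.add_apply, epsCoord_σmap, hd, Pi.single_apply, h0] at this
    rw [epsCoord_σmap]
    grind
  · exact .inl (key w hw h h0)

lemma eq_or_add_eq_smul_or_isLong (hn : 2 ≤ n) {v : Q n} (h : B n v v = 2) :
    σmap n v = v ∨ (∃ c : ℤ, v + σmap n v = c • δ n) ∨ IsLong v := by
  rw [B_eq_dotProduct hn] at h
  obtain ⟨i, j, s, t, hij, hs, ht, hd⟩ := exists_eq_single_add_single h
  by_cases hji : j = i.rev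
  · subst hji
    have hsum := sum_epsCoord hn v
    simp only [hd, Pi.add_apply, Finset.sum_add_distrib, Finset.sum_pi_single',
      Finset.mem_univ, if_true] at hsum
    by_cases hst : s = t
    · right; left
      refine ⟨_, eq_smul_δ_of_epsCoord_eq_zero hn ?_⟩
      ext k
      simp only [map_add, Pi.add_apply, epsCoord_σmap, hd, Pi.single_apply, Fin.rev_eq_iff,
        Fin.rev_rev, Pi.zero_apply]
      grind
    · left
      have he : epsCoord n (σmap n v) = epsCoord n v := by
        ext k
        simp only [Pi.add_apply, epsCoord_σmap, hd, Pi.single_apply, Fin.rev_eq_iff, Fin.rev_rev]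
        grind
      rw [eq_add_smul_δ_of_epsCoord_eq hn he, σmap_zero_apply,
        show v (Fin.last _) - v 0 = 0 by omega, zero_smul, add_zero]
  · exact .inr (.inr ⟨i, j, s, t, hij, hji, hs, ht, hd⟩)

lemma eq_or_isLong (hn : 2 ≤ n) {v : Q n} (h : B n v v = 2) (hO : ¬∃ c : ℤ, O n v = c • δ n) :
    σmap n v = v ∨ IsLong v := by
  rcases eq_or_add_eq_smul_or_isLong hn h with h1 | h1 | h1
  · exact .inl h1
  · by_cases he : σmap n v = v
    · exact .inl he
    · rw [O_of_ne he] at hO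
      exact absurd h1 hO
  · exact .inr h1

lemma O_injective (hn : 2 ≤ n) {v w : Q n} (hv : B n v v = 2) (hw : B n w w = 2)
    (hO : ¬∃ c : ℤ, O n v = c • δ n) (h : O n v = O n w) : v = w ∨ v = σmap n w := by
  rcases eq_or_isLong hn hv hO with h1 | h1 <;> rcases eq_or_isLong hn hw (h ▸ hO) with h2 | h2
  · rw [O_of_eq h1, O_of_eq h2] at h
    exact .inl h
  · rw [O_of_eq h1, O_of_ne (h2.σmap_ne hn)] at h
    have := h2.B_O_self hn
    rw [← h, hv] at this
    norm_num at this
  · rw [O_of_ne (h1.σmap_ne hn), O_of_eq h2] at h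
    have := h1.B_O_self hn
    rw [h, hw] at this
    norm_num at this
  · rw [O_of_ne (h1.σmap_ne hn), O_of_ne (h2.σmap_ne hn)] at h
    exact h1.eq_or_eq_σmap hn h2 h

lemma O_neg (v : Q n) : O n (-v) = -O n v := by
  unfold O
  simp only [σmap_neg, neg_inj]
  split_ifs
  · rfl
  · rw [neg_add]

lemma O_nonneg {v : Q n} (h : 0 ≤ v) : 0 ≤ O n v := by
  unfold O
  split_ifs
  · exact h
  · exact add_nonneg h fun i => h _

lemma ne_zero_of_B_self (hn : 2 ≤ n) {v : Q n} (h : B n v v = 2) : v ≠ 0 := by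
  rintro rfl
  rw [B_eq_dotProduct hn, map_zero, zero_dotProduct] at h
  norm_num at h

lemma O_ne_zero (hn : 2 ≤ n) {v : Q n} (h : 0 ≤ v) (hB : B n v v = 2) : O n v ≠ 0 := by
  intro h0
  unfold O at h0
  split_ifs at h0
  · exact ne_zero_of_B_self hn hB h0
  · refine ne_zero_of_B_self hn hB (le_antisymm ?_ h)
    rw [← h0]
    exact le_add_of_nonneg_right fun i => h _

lemma IsLong.O_add_smul_δ (hn : 2 ≤ n) {v : Q n} (h : IsLong v) (c : ℤ) :
    O n (v + c • δ n) = O n v + (2 * c) • δ n := by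
  rw [O_of_ne (h.σmap_ne hn), O_of_ne ((h.add_smul_δ hn c).σmap_ne hn), σmap_add_smul_δ hn,
    two_mul c, add_smul]
  abel

lemma O_add_smul_δ_of_eq (hn : 2 ≤ n) {v : Q n} (h : σmap n v = v) (c : ℤ) :
    O n (v + c • δ n) = O n v + c • δ n := by
  rw [O_of_eq h, O_of_eq (by rw [σmap_add_smul_δ hn, h])]

lemma O_apply_zero {β : Q n} (h : β ∈ Δ0' n) : O n β 0 = 0 := by
  obtain ⟨-, h0, hl⟩ := h
  unfold O
  split_ifs
  · exact h0
  · rw [Pi.add_apply, σmap_zero_apply, h0, zero_add]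
    exact hl

lemma IsLong.sub_smul_δ_mem (hn : 2 ≤ n) {v : Q n} (h : IsLong v)
    (h0 : v (Fin.last _) - v 0 = 0) :
    v + (-v 0) • δ n ∈ Δ0' n := by
  refine ⟨by rw [B_add_smul_δ hn, h.B_self hn], ?_, ?_⟩
  · simp [δ_zero]
  · change (v + (-v 0) • δ n) (Fin.last _) = 0
    simp only [Pi.add_apply, Pi.smul_apply, δ_last, smul_eq_mul, mul_one]
    linarith

/-- Modulo `δ`, every orbit sum outside `ℤδ` comes from the subsystem `Δ₀'`. -/
lemma exists_O_eq_O_add_smul_δ (hn : 2 ≤ n) {v : Q n} (h : B n v v = 2)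
    (hO : ¬∃ c : ℤ, O n v = c • δ n) : ∃ β ∈ Δ0' n, ∃ m : ℤ, O n v = O n β + m • δ n := by
  have of_last_sub_zero : ∀ {u : Q n}, IsLong u → u (Fin.last _) - u 0 = 0 →
      ∃ β ∈ Δ0' n, ∃ m : ℤ, O n u = O n β + m • δ n := fun {u} hu h0 =>
    ⟨_, hu.sub_smul_δ_mem hn h0, 2 * u 0, by
      rw [hu.O_add_smul_δ hn, add_assoc, ← add_smul]; simp⟩
  rcases eq_or_isLong hn h hO with h1 | h1
  · refine ⟨v + (-v 0) • δ n, ⟨by rw [B_add_smul_δ hn, h], ?_, ?_⟩, v 0, ?_⟩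
    · simp [δ_zero]
    · change (v + (-v 0) • δ n) (Fin.last _) = 0
      have : v (Fin.last _) = v 0 := by rw [← σmap_zero_apply v, h1]
      simp [δ_last, this]
    · rw [O_add_smul_δ_of_eq hn h1, add_assoc, ← add_smul]; simp
  · by_cases h0 : v (Fin.last _) - v 0 = 0
    · exact of_last_sub_zero h1 h0
    · obtain ⟨w, hw, ⟨a, ha⟩, c, -, hc⟩ := h1.exists_odd_shift hn
      have hv1 := h1.last_sub_zero hn
      have hw1 := hw.last_sub_zero hn
      obtain ⟨β, hβ, m, hm⟩ := of_last_sub_zero hw (by omega)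
      refine ⟨β, hβ, m - c, ?_⟩
      rw [sub_smul, ← add_sub_assoc, ← hm, O_of_ne (hw.σmap_ne hn), hc,
        O_of_ne (h1.σmap_ne hn), add_sub_cancel_right]

/-- Every translate by `ℤδ` of the orbit sum of a root is again the orbit sum of a root. -/
lemma exists_O_eq_of_O_add_smul_δ (hn : 2 ≤ n) {v : Q n} (h : B n v v = 2)
    (hO : ¬∃ c : ℤ, O n v = c • δ n) (m : ℤ) : ∃ w, B n w w = 2 ∧ O n w = O n v + m • δ n := by
  rcases eq_or_isLong hn h hO with h1 | h1
  · exact ⟨v + m • δ n, by rw [B_add_smul_δ hn, h], O_add_smul_δ_of_eq hn h1 m⟩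
  · rcases Int.even_or_odd' m with ⟨k, rfl | rfl⟩
    · exact ⟨v + k • δ n, by rw [B_add_smul_δ hn, h], h1.O_add_smul_δ hn k⟩
    · obtain ⟨w, hw, -, c, ⟨a, rfl⟩, hc⟩ := h1.exists_odd_shift hn
      refine ⟨w + (k - a) • δ n, by rw [B_add_smul_δ hn, hw.B_self hn], ?_⟩
      rw [hw.O_add_smul_δ hn, O_of_ne (hw.σmap_ne hn), hc, O_of_ne (h1.σmap_ne hn), add_assoc,
        ← add_smul]
      congr 2
      ring

lemma not_exists_O_eq_smul_δ {β : Q n} (h : β ∈ Δ0' n) (h0 : O n β ≠ 0) :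
    ¬∃ c : ℤ, O n β = c • δ n := by
  rintro ⟨c, hc⟩
  have := congrFun hc 0
  rw [O_apply_zero h, Pi.smul_apply, δ_zero, smul_eq_mul, mul_one] at this
  rw [hc, ← this, zero_smul] at h0
  exact h0 rfl

lemma neg_mem_Δ0' (hn : 2 ≤ n) {β : Q n} (h : β ∈ Δ0' n) : -β ∈ Δ0' n := by
  obtain ⟨h1, h2, h3⟩ := h
  refine ⟨?_, by rw [Pi.neg_apply, h2, neg_zero], by rw [Pi.neg_apply, h3, neg_zero]⟩
  rw [B_eq_dotProduct hn] at h1 ⊢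
  rw [map_neg, neg_dotProduct_neg, h1]

lemma O_mem_ulΔrePos (hn : 2 ≤ n) {v : Q n} (h : v ∈ ΔrePos n)
    (hO : ¬∃ c : ℤ, O n v = c • δ n) : O n v ∈ ulΔrePos n := by
  obtain ⟨hv, hB⟩ := h
  obtain ⟨β, hβ, m, hm⟩ := exists_O_eq_O_add_smul_δ hn hB hO
  have hm0 : O n v 0 = m := by
    rw [hm, Pi.add_apply, O_apply_zero hβ, Pi.smul_apply, δ_zero, smul_eq_mul, mul_one, zero_add]
  lift m to ℕ using hm0 ▸ O_nonneg hv 0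
  rcases nonneg_or_nonpos_of_B_self_eq_two hn hβ.1 with hs | hs
  · exact .inl ⟨_, ⟨β, ⟨hβ, hs⟩, rfl⟩, m, hm⟩
  · have hs' : 0 ≤ -β := neg_nonneg.2 hs
    refine .inr ⟨_, ⟨-β, ⟨neg_mem_Δ0' hn hβ, hs'⟩, rfl⟩, m, ?_, ?_⟩
    · by_contra hlt
      obtain rfl : m = 0 := by omega
      rw [Nat.cast_zero, zero_smul, add_zero] at hm
      have h1 := O_nonneg hs'
      rw [O_neg, ← hm, neg_nonneg] at h1
      exact O_ne_zero hn hv hB (le_antisymm h1 (O_nonneg hv))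
    · rw [hm, O_neg, sub_neg_eq_add, add_comm]

lemma exists_of_mem_ulΔrePos (hn : 2 ≤ n) {y : Q n} (hy : y ∈ ulΔrePos n) :
    ∃ β ∈ Δ0' n, ∃ m : ℤ, y = O n β + m • δ n ∧ O n β ≠ 0 ∧ (0 < m ∨ 0 ≤ m ∧ 0 ≤ O n β) := by
  rcases hy with ⟨_, ⟨β, ⟨hβ, hpos⟩, rfl⟩, m, rfl⟩ | ⟨_, ⟨β, ⟨hβ, hpos⟩, rfl⟩, m, hm, rfl⟩
  · exact ⟨β, hβ, m, rfl, O_ne_zero hn hpos hβ.1, .inr ⟨Nat.cast_nonneg m, O_nonneg hpos⟩⟩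
  · refine ⟨-β, neg_mem_Δ0' hn hβ, m, ?_, ?_, .inl (by exact_mod_cast hm)⟩
    · rw [O_neg]; abel
    · rw [O_neg]; exact neg_ne_zero.2 (O_ne_zero hn hpos hβ.1)

lemma exists_O_eq_of_mem_ulΔrePos (hn : 2 ≤ n) {y : Q n} (hy : y ∈ ulΔrePos n) :
    (∃ v ∈ ΔrePos n, O n v = y) ∧ ¬∃ c : ℤ, y = c • δ n := by
  obtain ⟨β, hβ, m, rfl, h0, hm⟩ := exists_of_mem_ulΔrePos hn hy
  have hβδ := not_exists_O_eq_smul_δ hβ h0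
  refine ⟨?_, fun ⟨c, hc⟩ => hβδ ⟨c - m, by rw [sub_smul, ← hc, add_sub_cancel_right]⟩⟩
  obtain ⟨v, hB, hv⟩ := exists_O_eq_of_O_add_smul_δ hn hβ.1 hβδ m
  refine ⟨v, ⟨?_, hB⟩, hv⟩
  rcases nonneg_or_nonpos_of_B_self_eq_two hn hB with hs | hs
  · exact hs
  · have h1 := O_nonneg (neg_nonneg.2 hs)
    rw [O_neg, hv, neg_nonneg] at h1
    have h2 := h1 0
    rw [Pi.add_apply, O_apply_zero hβ, Pi.smul_apply, δ_zero, smul_eq_mul, mul_one, zero_add,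
      Pi.zero_apply] at h2
    rcases hm with hm | ⟨hm, hpos⟩
    · exact absurd h2 (not_le.2 hm)
    · obtain rfl : m = 0 := le_antisymm h2 hm
      rw [zero_smul, add_zero] at h1
      exact absurd (le_antisymm h1 hpos) h0

lemma orb_eq_pair (v : Q n) : orb n v = {v, σmap n v} := by
  have h2 : (σmap n)^[2] = id := funext σmap_σmap
  ext w
  constructor
  · rintro ⟨k, rfl⟩
    rcases Nat.even_or_odd' k with ⟨m, rfl | rfl⟩
    · left
      rw [Function.iterate_mul, h2, Function.iterate_id, id]
    · right
      rw [Set.mem_singleton_iff, Function.iterate_succ_apply', Function.iterate_mul, h2,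
        Function.iterate_id, id]
  · rintro (rfl | rfl)
    · exact ⟨0, rfl⟩
    · exact ⟨1, rfl⟩

lemma finsum_mem_orb (v : Q n) : ∑ᶠ u ∈ orb n v, u = O n v := by
  rw [orb_eq_pair]
  by_cases h : σmap n v = v
  · rw [h, Set.pair_eq_singleton, finsum_mem_singleton, O_of_eq h]
  · rw [finsum_mem_pair (Ne.symm h), O_of_ne h]

end

theorem statement9 (n : ℕ) (hn : 2 ≤ n) :
    (∀ v ∈ ΔrePos n,
      (∃ m : ℤ, 0 < m ∧ O n v = m • δ n) ∨ O n v ∈ ulΔrePos n) ∧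
    Set.BijOn (fun ω => ∑ᶠ u ∈ ω, u)
      {ω ∈ Orbits n | ¬ ∃ m : ℤ, (∑ᶠ u ∈ ω, u) = m • δ n}
      (ulΔrePos n) := by
  refine ⟨fun v hv => ?_, ?_, ?_, ?_⟩
  · by_cases h : ∃ c : ℤ, O n v = c • δ n
    · obtain ⟨c, hc⟩ := h
      refine .inl ⟨c, ?_, hc⟩
      have h0 := O_nonneg hv.1 0
      rw [hc, Pi.zero_apply, Pi.smul_apply, δ_zero, smul_eq_mul, mul_one] at h0
      refine h0.lt_of_ne fun he => O_ne_zero hn hv.1 hv.2 ?_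
      rw [hc, ← he, zero_smul]
    · exact .inr (O_mem_ulΔrePos hn hv h)
  · rintro _ ⟨⟨v, hv, rfl⟩, hO⟩
    simp only [finsum_mem_orb] at hO ⊢
    exact O_mem_ulΔrePos hn hv hO
  · rintro _ ⟨⟨v, hv, rfl⟩, hO⟩ _ ⟨⟨w, hw, rfl⟩, -⟩ h
    simp only [finsum_mem_orb] at hO h
    rw [orb_eq_pair, orb_eq_pair]
    rcases O_injective hn hv.2 hw.2 hO h with rfl | rfl
    · rfl
    · rw [σmap_σmap, Set.pair_comm]
  · intro y hy
    obtain ⟨⟨v, hv, rfl⟩, hO⟩ := exists_O_eq_of_mem_ulΔrePos hn hy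
    exact ⟨orb n v, ⟨⟨v, hv, rfl⟩, by rwa [finsum_mem_orb]⟩, finsum_mem_orb v⟩

end Stmt9
end

section
/- For v \in \Delta^{re,+} let O(v) denote the sum of the distinct elements of the \sigma-orbit of v (so O(v) = v if \sigma(v) = v and O(v) = v + \sigma(v) otherwise). Define \underline{\Delta}_0^+ = \{O(\beta) : \beta \in \Delta_0'^+\} and \underline{\Delta}^{re,+} = \{x + m\delta : x \in \underline{\Delta}_0^+, m \in \mathbb{Z}_{\ge 0}\} \cup \{m\delta - x : x \in \underline{\Delta}_0^+, m \in \mathbb{Z}_{\ge 1}\}. Then: (i) for every v \in \Delta^{re,+}, either O(v) \in \mathbb{Z}_{>0}\cdot\delta or O(v) \in \underline{\Delta}^{re,+}; (ii) the assignment \omega \mapsto \sum_{u \in \omega} u defines a bijection from the set of \sigma-orbits \omega on \Delta^{re,+} whose element-sum does not lie in \mathbb{Z}\cdot\delta onto \underline{\Delta}^{re,+} (the positive real root system of affine type C_{n-2}^{(1)}). -/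
/-!
Statement 10: For the affine root system of type `D_n^{(1)}` (`n ≥ 4`) with the
admissible diagram automorphism `σ` swapping `α_0 ↔ α_1` and `α_{n-1} ↔ α_n`,
let `O(v)` be the sum of the distinct elements of the `σ`-orbit of `v`,
`ulΔ₀⁺ = O(Δ₀'⁺)` and
`ulΔ^{re,+} = {x + mδ : x ∈ ulΔ₀⁺, m ≥ 0} ∪ {mδ - x : x ∈ ulΔ₀⁺, m ≥ 1}`.
Then (i) for every positive real root `v`, either `O(v) ∈ ℤ_{>0}·δ` or
`O(v) ∈ ulΔ^{re,+}`; (ii) `ω ↦ ∑_{u ∈ ω} u` is a bijection from the set of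
`σ`-orbits on `Δ^{re,+}` whose element-sum is not in `ℤ·δ` onto `ulΔ^{re,+}`
(the positive real roots of type `C_{n-2}^{(1)}`).
-/

namespace Stmt10

/-- The root lattice `Q = ⨁_{i ∈ I} ℤ α_i` for `I = {0,1,…,n}`. -/
abbrev Q (n : ℕ) := Fin (n + 1) → ℤ

/-- The edges of the Dynkin diagram of affine type `D_n^{(1)}`. -/
abbrev edge (n i j : ℕ) : Prop :=
  (i + 1 = j ∧ 2 ≤ i ∧ j ≤ n - 1) ∨ (j + 1 = i ∧ 2 ≤ j ∧ i ≤ n - 1) ∨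
  (i = 0 ∧ j = 2) ∨ (i = 2 ∧ j = 0) ∨ (i = 1 ∧ j = 2) ∨ (i = 2 ∧ j = 1) ∨
  (i = n - 2 ∧ j = n) ∨ (i = n ∧ j = n - 2)

/-- The generalized Cartan matrix of type `D_n^{(1)}`. -/
def CM (n : ℕ) (i j : Fin (n + 1)) : ℤ :=
  if i = j then 2 else if edge n (i : ℕ) (j : ℕ) then -1 else 0

/-- The symmetric bilinear form `B` on `Q` determined by the Cartan matrix. -/
def B (n : ℕ) (v w : Q n) : ℤ := ∑ i, ∑ j, v i * CM n i j * w j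

/-- The set of positive real roots. -/
def ΔrePos (n : ℕ) : Set (Q n) := {v | (∀ i, 0 ≤ v i) ∧ B n v v = 2}

/-- The primitive null root `δ`. -/
def δ (n : ℕ) : Q n := fun i =>
  if (i : ℕ) = 0 ∨ (i : ℕ) = 1 ∨ (i : ℕ) = n - 1 ∨ (i : ℕ) = n then 1 else 2

/-- The involution of the index set `{0,…,n}` swapping `0 ↔ 1` and `n-1 ↔ n`
(for `n ≥ 4`). -/
def τ (n : ℕ) (i : Fin (n + 1)) : Fin (n + 1) :=
  ⟨if (i : ℕ) = 0 then min 1 n else if (i : ℕ) = 1 then 0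
    else if (i : ℕ) = n - 1 then n else if (i : ℕ) = n then n - 1 else (i : ℕ),
   by have := i.isLt; split_ifs <;> omega⟩

/-- The admissible diagram automorphism `σ` (on coordinates). -/
def σmap (n : ℕ) (v : Q n) : Q n := fun i => v (τ n i)

/-- The `σ`-stable subsystem `Δ₀'` of type `D_{n-1}` supported on `I ∖ {0, 1}`. -/
def Δ0' (n : ℕ) : Set (Q n) := {v | B n v v = 2 ∧ v 0 = 0 ∧ v 1 = 0}

/-- The positive part `Δ₀'⁺ = Δ₀' ∩ ℕ^I`. -/
def Δ0'Pos (n : ℕ) : Set (Q n) := {v | v ∈ Δ0' n ∧ ∀ i, 0 ≤ v i}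

/-- `O(v)`: the sum of the distinct elements of the `σ`-orbit of `v`
(here `σ` has order 2, so `O(v) = v` if `σ(v) = v` and `O(v) = v + σ(v)` otherwise). -/
noncomputable def O (n : ℕ) (v : Q n) : Q n :=
  if σmap n v = v then v else v + σmap n v

/-- `ulΔ₀⁺ = {O(β) : β ∈ Δ₀'⁺}` (a positive system of type `C_{n-2}`). -/
noncomputable def ulΔ0Pos (n : ℕ) : Set (Q n) := O n '' Δ0'Pos n

/-- `ulΔ^{re,+}`, the positive real roots of affine type `C_{n-2}^{(1)}`. -/
noncomputable def ulΔrePos (n : ℕ) : Set (Q n) :=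
  {y | ∃ x ∈ ulΔ0Pos n, ∃ m : ℕ, y = x + (m : ℤ) • δ n} ∪
  {y | ∃ x ∈ ulΔ0Pos n, ∃ m : ℕ, 1 ≤ m ∧ y = (m : ℤ) • δ n - x}

/-- The `σ`-orbit of `v`. -/
def orb (n : ℕ) (v : Q n) : Set (Q n) := {w | ∃ k : ℕ, w = (σmap n)^[k] v}

/-- The set of `σ`-orbits on `Δ^{re,+}`. -/
def Orbits (n : ℕ) : Set (Set (Q n)) := {ω | ∃ v ∈ ΔrePos n, ω = orb n v}

/-- The `k`-th coordinate of `v`, extended by zero beyond `n`. -/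
def coord {n : ℕ} (v : Q n) (k : ℕ) : ℤ := if h : k < n + 1 then v ⟨k, h⟩ else 0

/-- The coefficient of `ε_k` in the realization `α_0 = δ - ε_1 - ε_2`, `α_i = ε_i - ε_{i+1}`,
`α_n = ε_{n-1} + ε_n` of the simple roots. -/
def epsCoeff (n i k : ℕ) : ℤ :=
  (if i = k then 1 else 0) - (if i + 1 = k then 1 else 0)
    - (if 2 = k then (if i = 0 then 1 else 0) else 0)
    + (if n - 1 = k then (if i = n then 1 else 0) else 0)

/-- The `k`-th `ε`-coordinate of `v`, for `1 ≤ k ≤ n`. -/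
def eps {n : ℕ} (v : Q n) (k : ℕ) : ℤ := ∑ i : Fin (n + 1), v i * epsCoeff n i k

lemma sum_ite_val_eq {n : ℕ} (v : Q n) (k : ℕ) :
    (∑ i : Fin (n + 1), if (i : ℕ) = k then v i else 0) = coord v k := by
  unfold coord
  split_ifs with h
  · rw [Finset.sum_eq_single ⟨k, h⟩]
    · simp
    · intro b _ hb
      rw [if_neg]
      intro e
      exact hb (Fin.ext e)
    · simp
  · apply Finset.sum_eq_zero
    intro i _
    rw [if_neg]
    omega

lemma eps_eq {n : ℕ} (v : Q n) {k : ℕ} (hk : 1 ≤ k) :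
    eps v k = coord v k - coord v (k - 1) - (if 2 = k then coord v 0 else 0)
      + (if n - 1 = k then coord v n else 0) := by
  simp only [← sum_ite_val_eq, eps]
  have e : ∀ i : Fin (n + 1), v i * epsCoeff n i k =
      (if (i : ℕ) = k then v i else 0) - (if (i : ℕ) = k - 1 then v i else 0)
      - (if 2 = k then (if (i : ℕ) = 0 then v i else 0) else 0)
      + (if n - 1 = k then (if (i : ℕ) = n then v i else 0) else 0) := by
    intro i
    have h1 : ((i : ℕ) + 1 = k) ↔ ((i : ℕ) = k - 1) := by omega
    simp only [epsCoeff, h1, mul_add, mul_sub, mul_ite, mul_one, mul_zero]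
  simp only [e, Finset.sum_add_distrib, Finset.sum_sub_distrib]
  split_ifs <;> simp

lemma CM_eq_sum {n : ℕ} (hn : 4 ≤ n) (i j : Fin (n + 1)) :
    CM n i j = ∑ k ∈ Finset.Icc 1 n, epsCoeff n i k * epsCoeff n j k := by
  have hi := i.isLt
  have hj := j.isLt
  have e : ∀ k, epsCoeff n i k * epsCoeff n j k =
      (if (i : ℕ) = k then epsCoeff n j k else 0) - (if (i : ℕ) + 1 = k then epsCoeff n j k else 0)
      - (if 2 = k then (if (i : ℕ) = 0 then epsCoeff n j k else 0) else 0)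
      + (if n - 1 = k then (if (i : ℕ) = n then epsCoeff n j k else 0) else 0) := by
    intro k
    rw [epsCoeff]
    simp only [add_mul, sub_mul, ite_mul, one_mul, zero_mul]
  simp only [e, Finset.sum_add_distrib, Finset.sum_sub_distrib, Finset.sum_ite_eq, Finset.mem_Icc]
  simp only [CM, Fin.ext_iff, edge, epsCoeff]
  generalize (i : ℕ) = i at *
  generalize (j : ℕ) = j at *
  rcases (by omega : i = 0 ∨ i = n ∨ (1 ≤ i ∧ i < n)) with h | h | h <;>
  rcases (by omega : j = 0 ∨ j = n ∨ (1 ≤ j ∧ j < n)) with h' | h' | h' <;>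
  grind (splits := 30)

lemma B_eq_sum {n : ℕ} (hn : 4 ≤ n) (v w : Q n) :
    B n v w = ∑ k ∈ Finset.Icc 1 n, eps v k * eps w k := by
  simp only [B, CM_eq_sum hn, eps, Finset.mul_sum, Finset.sum_mul]
  rw [Finset.sum_comm]
  rw [Finset.sum_comm' (t' := Finset.univ) (s' := fun _ => Finset.Icc 1 n) (by simp)]
  refine Finset.sum_congr rfl fun i _ => ?_
  rw [Finset.sum_comm]
  refine Finset.sum_congr rfl fun i _ => Finset.sum_congr rfl fun i _ => ?_
  ring

/-- The sum of the squares of the inner `ε`-coordinates, those fixed by `σ`. -/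
def midNorm {n : ℕ} (v : Q n) : ℤ := ∑ k ∈ Finset.Icc 2 (n - 1), eps v k ^ 2

/-- The element `ε_1 - ε_n` of the root lattice. -/
def η (n : ℕ) : Q n := fun i => if 1 ≤ (i : ℕ) ∧ (i : ℕ) < n then 1 else 0

section linearity

variable {n : ℕ} (v w : Q n) (k : ℕ)

lemma eps_add : eps (v + w) k = eps v k + eps w k := by
  simp [eps, add_mul, Finset.sum_add_distrib]

lemma eps_sub : eps (v - w) k = eps v k - eps w k := by
  simp [eps, sub_mul, Finset.sum_sub_distrib]

lemma eps_smul (m : ℤ) : eps (m • v) k = m * eps v k := by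
  simp [eps, Finset.mul_sum, mul_assoc]

lemma coord_add : coord (v + w) k = coord v k + coord w k := by
  unfold coord; split_ifs <;> simp

lemma coord_sub : coord (v - w) k = coord v k - coord w k := by
  unfold coord; split_ifs <;> simp

lemma coord_neg : coord (-v) k = -coord v k := by
  unfold coord; split_ifs <;> simp

lemma coord_smul (m : ℤ) : coord (m • v) k = m * coord v k := by
  unfold coord; split_ifs <;> simp

end linearity

lemma apply_eq_coord {n : ℕ} (v : Q n) (i : Fin (n + 1)) : v i = coord v i := by
  simp [coord, i.isLt]

lemma ext_coord {n : ℕ} {v w : Q n} (h : ∀ k ≤ n, coord v k = coord w k) : v = w := by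
  funext i
  rw [apply_eq_coord v, apply_eq_coord w, h _ (by omega)]

lemma coord_nonneg {n : ℕ} {v : Q n} (h : ∀ i, 0 ≤ v i) (k : ℕ) : 0 ≤ coord v k := by
  unfold coord; split_ifs
  · exact h _
  · rfl

lemma apply_one {n : ℕ} (hn : 4 ≤ n) (v : Q n) : v 1 = coord v 1 := by
  rw [apply_eq_coord v, Fin.val_one', Nat.mod_eq_of_lt (by omega)]

lemma coord_δ {n : ℕ} {k : ℕ} (hk : k ≤ n) :
    coord (δ n) k = if k = 0 ∨ k = 1 ∨ k = n - 1 ∨ k = n then 1 else 2 := by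
  simp [coord, δ, Nat.lt_succ_of_le hk]

lemma coord_η {n : ℕ} {k : ℕ} (hk : k ≤ n) :
    coord (η n) k = if 1 ≤ k ∧ k < n then 1 else 0 := by
  simp [coord, η, Nat.lt_succ_of_le hk]

lemma coord_σmap {n : ℕ} (v : Q n) {k : ℕ} (hk : k ≤ n) :
    coord (σmap n v) k = coord v (if k = 0 then min 1 n else if k = 1 then 0
      else if k = n - 1 then n else if k = n then n - 1 else k) := by
  have h := (τ n ⟨k, Nat.lt_succ_of_le hk⟩).isLt
  simp only [τ] at h
  simp [coord, σmap, τ, Nat.lt_succ_of_le hk, h]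

section

variable {n : ℕ} (hn : 4 ≤ n)
include hn

lemma σmap_σmap (v : Q n) : σmap n (σmap n v) = v := by
  apply ext_coord
  intro k hk
  rw [coord_σmap _ hk, coord_σmap _ (by split_ifs <;> omega)]
  congr 1
  split_ifs <;> omega

lemma σmap_δ : σmap n (δ n) = δ n := by
  apply ext_coord
  intro k hk
  rw [coord_σmap _ hk, coord_δ hk, coord_δ (by split_ifs <;> omega)]
  split_ifs <;> omega

lemma η_add_σmap_η : η n + σmap n (η n) = δ n := by
  apply ext_coord
  intro k hk
  rw [coord_add, coord_σmap _ hk, coord_δ hk, coord_η hk, coord_η (by split_ifs <;> omega)]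
  split_ifs <;> omega

lemma eps_one (v : Q n) : eps v 1 = coord v 1 - coord v 0 := by
  rw [eps_eq _ le_rfl, if_neg (by omega), if_neg (by omega)]
  simp

lemma eps_last (v : Q n) : eps v n = coord v n - coord v (n - 1) := by
  rw [eps_eq _ (by omega), if_neg (by omega), if_neg (by omega)]
  simp

lemma coord_σmap_zero (v : Q n) : coord (σmap n v) 0 = coord v 1 := by
  rw [coord_σmap _ (by omega), if_pos rfl, min_eq_left (by omega)]

lemma coord_σmap_one (v : Q n) : coord (σmap n v) 1 = coord v 0 := by
  rw [coord_σmap _ (by omega), if_neg (by omega), if_pos rfl]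

lemma coord_σmap_pred (v : Q n) : coord (σmap n v) (n - 1) = coord v n := by
  rw [coord_σmap _ (by omega), if_neg (by omega), if_neg (by omega), if_pos rfl]

lemma coord_σmap_last (v : Q n) : coord (σmap n v) n = coord v (n - 1) := by
  rw [coord_σmap _ le_rfl, if_neg (by omega), if_neg (by omega), if_neg (by omega), if_pos rfl]

lemma coord_σmap_mid (v : Q n) {k : ℕ} (h2 : 2 ≤ k) (hk : k ≤ n - 2) :
    coord (σmap n v) k = coord v k := by
  rw [coord_σmap _ (by omega), if_neg (by omega), if_neg (by omega), if_neg (by omega),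
    if_neg (by omega)]

lemma eps_σmap_one (v : Q n) : eps (σmap n v) 1 = -eps v 1 := by
  rw [eps_one hn, eps_one hn, coord_σmap_zero hn, coord_σmap_one hn]
  ring

lemma eps_σmap_last (v : Q n) : eps (σmap n v) n = -eps v n := by
  rw [eps_last hn, eps_last hn, coord_σmap_pred hn, coord_σmap_last hn]
  ring

lemma eps_σmap_mid (v : Q n) {k : ℕ} (h2 : 2 ≤ k) (hk : k ≤ n - 1) :
    eps (σmap n v) k = eps v k := by
  rw [eps_eq _ (by omega), eps_eq _ (by omega), coord_σmap_zero hn, coord_σmap_last hn]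
  rcases (by omega : k = 2 ∨ k = n - 1 ∨ (3 ≤ k ∧ k ≤ n - 2)) with rfl | rfl | ⟨h3, h4⟩
  · rw [coord_σmap_mid hn v le_rfl (by omega), coord_σmap_one hn, if_pos rfl, if_pos rfl,
      if_neg (by omega), if_neg (by omega)]
    ring
  · rw [coord_σmap_pred hn, coord_σmap_mid hn v (by omega) (by omega)]
    simp only [show ¬ 2 = n - 1 by omega, if_true, if_false]
    ring
  · rw [coord_σmap_mid hn v h2 h4, coord_σmap_mid hn v (by omega) (by omega), if_neg (by omega),
      if_neg (by omega), if_neg (by omega), if_neg (by omega)]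

lemma eps_δ {k : ℕ} (h : 1 ≤ k) (hk : k ≤ n) : eps (δ n) k = 0 := by
  rw [eps_eq _ h, coord_δ hk, coord_δ (by omega), coord_δ (by omega), coord_δ (by omega)]
  split_ifs <;> omega

lemma eps_η_one : eps (η n) 1 = 1 := by
  rw [eps_one hn, coord_η (by omega), coord_η (by omega)]
  split_ifs <;> omega

lemma eps_η_last : eps (η n) n = -1 := by
  rw [eps_last hn, coord_η (by omega), coord_η (by omega)]
  split_ifs <;> omega

lemma eps_η_mid {k : ℕ} (h2 : 2 ≤ k) (hk : k ≤ n - 1) : eps (η n) k = 0 := by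
  rw [eps_eq _ (by omega), coord_η (by omega), coord_η (by omega), coord_η (by omega),
    coord_η (by omega)]
  split_ifs <;> omega

lemma eq_smul_δ_of_eps_eq_zero {v : Q n} (h1 : eps v 1 = 0) (hl : eps v n = 0)
    (h : ∀ k, 2 ≤ k → k ≤ n - 1 → eps v k = 0) : v = coord v 0 • δ n := by
  have hm : ∀ k, 2 ≤ k → k ≤ n - 2 → coord v k = 2 * coord v 0 := by
    intro k h2
    induction k, h2 using Nat.le_induction with
    | base =>
      intro _
      have e := h 2 le_rfl (by omega)
      rw [eps_eq _ (by omega), if_pos rfl, if_neg (by omega)] at e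
      rw [eps_one hn] at h1
      norm_num at e
      omega
    | succ k h2 ih =>
      intro hk
      have e := h (k + 1) (by omega) (by omega)
      rw [eps_eq _ (by omega), if_neg (by omega), if_neg (by omega)] at e
      simp only [Nat.add_sub_cancel] at e
      have := ih (by omega)
      omega
  have e := h (n - 1) (by omega) le_rfl
  rw [eps_eq _ (by omega), if_neg (by omega), if_pos rfl, Nat.sub_sub,
    hm (n - 2) (by omega) le_rfl] at e
  rw [eps_last hn] at hl
  rw [eps_one hn] at h1
  apply ext_coord
  intro k hk
  rw [coord_smul, coord_δ hk]
  rcases (by omega : k = 0 ∨ k = 1 ∨ k = n - 1 ∨ k = n ∨ (2 ≤ k ∧ k ≤ n - 2))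
    with rfl | rfl | rfl | rfl | h'
  · simp
  · simp; omega
  · simp; omega
  · simp; omega
  · rw [if_neg (by omega), hm k h'.1 h'.2]; ring

lemma B_self (v : Q n) : B n v v = eps v 1 ^ 2 + eps v n ^ 2 + midNorm v := by
  have e : Finset.Icc 1 n = insert 1 (insert n (Finset.Icc 2 (n - 1))) := by
    ext k; simp; omega
  rw [B_eq_sum hn, e, Finset.sum_insert (by simp; omega), Finset.sum_insert (by simp; omega),
    midNorm]
  simp only [sq]
  ring

end

lemma midNorm_nonneg {n : ℕ} (v : Q n) : 0 ≤ midNorm v :=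
  Finset.sum_nonneg fun _ _ => sq_nonneg _

lemma eps_eq_zero_of_midNorm {n : ℕ} {v : Q n} (h : midNorm v = 0) {k : ℕ} (h2 : 2 ≤ k)
    (hk : k ≤ n - 1) : eps v k = 0 := by
  have := (Finset.sum_eq_zero_iff_of_nonneg fun _ _ => sq_nonneg _).1 h k
    (Finset.mem_Icc.2 ⟨h2, hk⟩)
  exact pow_eq_zero_iff (two_ne_zero) |>.1 this

lemma midNorm_congr {n : ℕ} {v w : Q n}
    (h : ∀ k, 2 ≤ k → k ≤ n - 1 → eps v k ^ 2 = eps w k ^ 2) : midNorm v = midNorm w :=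
  Finset.sum_congr rfl fun k hk => h k (Finset.mem_Icc.1 hk).1 (Finset.mem_Icc.1 hk).2

lemma even_sum_epsCoeff {n : ℕ} (hn : 4 ≤ n) {i : ℕ} (hi : i ≤ n) :
    Even (∑ k ∈ Finset.Icc 1 n, epsCoeff n i k) := by
  simp only [epsCoeff, Finset.sum_add_distrib, Finset.sum_sub_distrib, Finset.sum_ite_eq,
    Finset.mem_Icc]
  rw [Int.even_iff]
  split_ifs <;> omega

lemma O_of_fixed {n : ℕ} {v : Q n} (h : σmap n v = v) : O n v = v := if_pos h

lemma O_of_not_fixed {n : ℕ} {v : Q n} (h : σmap n v ≠ v) : O n v = v + σmap n v := if_neg h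

lemma σmap_add {n : ℕ} (v w : Q n) : σmap n (v + w) = σmap n v + σmap n w := rfl

lemma σmap_smul {n : ℕ} (m : ℤ) (v : Q n) : σmap n (m • v) = m • σmap n v := rfl

lemma σmap_neg {n : ℕ} (v : Q n) : σmap n (-v) = -σmap n v := rfl

lemma O_neg {n : ℕ} (v : Q n) : O n (-v) = -O n v := by
  by_cases h : σmap n v = v
  · rw [O_of_fixed h, O_of_fixed (by rw [σmap_neg, h])]
  · rw [O_of_not_fixed h, O_of_not_fixed (by rwa [σmap_neg, Ne, neg_inj]), σmap_neg]
    abel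

section

variable {n : ℕ} (hn : 4 ≤ n)
include hn

lemma B_self_nonneg (v : Q n) : 0 ≤ B n v v := by
  have := midNorm_nonneg v
  rw [B_self hn]
  positivity

lemma even_B_self (v : Q n) : Even (B n v v) := by
  have h1 : Even (∑ k ∈ Finset.Icc 1 n, eps v k) := by
    simp only [eps]
    rw [Finset.sum_comm]
    refine Finset.even_sum _ fun i _ => ?_
    rw [← Finset.mul_sum]
    exact (even_sum_epsCoeff hn (by omega)).mul_left _
  have h2 : Even (∑ k ∈ Finset.Icc 1 n, eps v k * (eps v k + 1)) :=
    Finset.even_sum _ fun k _ => Int.even_mul_succ_self _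
  have h3 := h2.sub h1
  rw [← Finset.sum_sub_distrib] at h3
  rw [B_eq_sum hn]
  have e : ∀ k, eps v k * (eps v k + 1) - eps v k = eps v k * eps v k := fun k => by ring
  simpa only [e] using h3

lemma eq_smul_δ_of_B_self {v : Q n} (h : B n v v = 0) : v = coord v 0 • δ n := by
  rw [B_self hn] at h
  have := midNorm_nonneg v
  have h1 := sq_nonneg (eps v 1)
  have h2 := sq_nonneg (eps v n)
  exact eq_smul_δ_of_eps_eq_zero hn (pow_eq_zero_iff two_ne_zero |>.1 (by omega))
    (pow_eq_zero_iff two_ne_zero |>.1 (by omega))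
    fun k => eps_eq_zero_of_midNorm (by omega)

lemma B_sub_self (v w : Q n) : B n (v - w) (v - w) = B n v v + B n w w - 2 * B n v w := by
  simp only [B_eq_sum hn, eps_sub, Finset.mul_sum]
  rw [← Finset.sum_add_distrib, ← Finset.sum_sub_distrib]
  exact Finset.sum_congr rfl fun k _ => by ring

omit hn in
lemma δ_pos (i : Fin (n + 1)) : 0 < δ n i := by
  unfold δ; split_ifs <;> norm_num

lemma pos_or_eq_zero_of_B_self {v : Q n} (h0 : ∀ i, 0 ≤ v i) (h : B n v v = 0) :
    (∀ i, 0 < v i) ∨ v = 0 := by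
  have e := eq_smul_δ_of_B_self hn h
  rcases (coord_nonneg h0 0).eq_or_lt with hc | hc
  · right
    rw [e, ← hc, zero_smul]
  · left
    intro i
    rw [e]
    exact mul_pos hc (δ_pos i)

lemma nonneg_or_nonpos {v : Q n} (h : B n v v = 2) : (∀ i, 0 ≤ v i) ∨ (∀ i, v i ≤ 0) := by
  set p : Q n := fun i => max (v i) 0 with hp
  set q : Q n := fun i => max (-v i) 0 with hq
  have hp0 : ∀ i, 0 ≤ p i := fun i => le_max_right _ _
  have hq0 : ∀ i, 0 ≤ q i := fun i => le_max_right _ _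
  have hpq : v = p - q := by
    funext i
    simp only [hp, hq, Pi.sub_apply]
    omega
  have hB : B n p q ≤ 0 := by
    refine Finset.sum_nonpos fun i _ => Finset.sum_nonpos fun j _ => ?_
    by_cases hij : i = j
    · subst hij
      have : p i = 0 ∨ q i = 0 := by simp only [hp, hq]; omega
      rcases this with h | h <;> simp [h]
    · have : CM n i j ≤ 0 := by
        rw [CM, if_neg hij]
        split_ifs <;> norm_num
      exact mul_nonpos_of_nonpos_of_nonneg
        (mul_nonpos_of_nonneg_of_nonpos (hp0 i) this) (hq0 j)
  have e := B_sub_self hn p q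
  rw [← hpq, h] at e
  have h1 := B_self_nonneg hn p
  have h2 := B_self_nonneg hn q
  obtain ⟨a, ha⟩ := even_B_self hn p
  obtain ⟨b, hb⟩ := even_B_self hn q
  rcases (by omega : B n p p = 0 ∨ B n q q = 0) with h | h
  · rcases pos_or_eq_zero_of_B_self hn hp0 h with h' | h'
    · left; intro i
      have := h' i
      simp only [hp] at this
      omega
    · right; intro i
      have := congrFun h' i
      simp only [hp, Pi.zero_apply] at this
      omega
  · rcases pos_or_eq_zero_of_B_self hn hq0 h with h' | h'
    · right; intro i
      have := h' i
      simp only [hq] at this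
      omega
    · left; intro i
      have := congrFun h' i
      simp only [hq, Pi.zero_apply] at this
      omega

lemma B_σmap_self (v : Q n) : B n (σmap n v) (σmap n v) = B n v v := by
  rw [B_self hn, B_self hn, eps_σmap_one hn, eps_σmap_last hn,
    midNorm_congr (v := σmap n v) (w := v) fun k h2 hk => by rw [eps_σmap_mid hn v h2 hk]]
  ring

lemma O_σmap (v : Q n) : O n (σmap n v) = O n v := by
  by_cases h : σmap n v = v
  · rw [h]
  · rw [O_of_not_fixed h, O_of_not_fixed (by rw [σmap_σmap hn]; exact Ne.symm h), σmap_σmap hn,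
      add_comm]

omit hn in
lemma O_nonneg {v : Q n} (h : ∀ i, 0 ≤ v i) (i : Fin (n + 1)) : 0 ≤ O n v i := by
  unfold O
  split_ifs
  · exact h i
  · exact add_nonneg (h i) (h _)

omit hn in
lemma O_ne_zero {v : Q n} (h : ∀ i, 0 ≤ v i) (hB : B n v v = 2) : O n v ≠ 0 := by
  intro e
  have : v = 0 := by
    funext i
    have := congrFun e i
    unfold O at this
    split_ifs at this
    · exact this
    · have h1 := h i
      have h2 : 0 ≤ σmap n v i := h _
      simp only [Pi.add_apply, Pi.zero_apply] at this ⊢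
      omega
  simp [this, B] at hB

lemma σmap_eq_self {v : Q n} (h1 : eps v 1 = 0) (hl : eps v n = 0) : σmap n v = v := by
  rw [eps_one hn] at h1
  rw [eps_last hn] at hl
  apply ext_coord
  intro k hk
  rcases (by omega : k = 0 ∨ k = 1 ∨ k = n - 1 ∨ k = n ∨ (2 ≤ k ∧ k ≤ n - 2))
    with rfl | rfl | rfl | rfl | h'
  · rw [coord_σmap_zero hn]; omega
  · rw [coord_σmap_one hn]; omega
  · rw [coord_σmap_pred hn]; omega
  · rw [coord_σmap_last hn]; omega
  · rw [coord_σmap_mid hn v h'.1 h'.2]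

lemma eps_of_fixed {v : Q n} (h : σmap n v = v) : eps v 1 = 0 ∧ eps v n = 0 := by
  have h1 := eps_σmap_one hn v
  have h2 := eps_σmap_last hn v
  rw [h] at h1 h2
  omega

lemma eps_of_not_fixed {v : Q n} (hB : B n v v = 2) (h : σmap n v ≠ v)
    (hδ : ¬ ∃ m : ℤ, O n v = m • δ n) :
    (eps v 1 = 0 ∧ (eps v n = 1 ∨ eps v n = -1)) ∨
      (eps v n = 0 ∧ (eps v 1 = 1 ∨ eps v 1 = -1)) := by
  have hm := midNorm_nonneg v
  rw [B_self hn] at hB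
  have b1 : -1 ≤ eps v 1 ∧ eps v 1 ≤ 1 := ⟨by nlinarith, by nlinarith⟩
  have b2 : -1 ≤ eps v n ∧ eps v n ≤ 1 := ⟨by nlinarith, by nlinarith⟩
  have h0 : ¬ (eps v 1 = 0 ∧ eps v n = 0) := fun h' => h (σmap_eq_self hn h'.1 h'.2)
  by_contra hc
  have e1 : eps v 1 ^ 2 = 1 := by
    rcases (by omega : eps v 1 = 1 ∨ eps v 1 = -1) with e | e <;> rw [e] <;> norm_num
  have e2 : eps v n ^ 2 = 1 := by
    rcases (by omega : eps v n = 1 ∨ eps v n = -1) with e | e <;> rw [e] <;> norm_num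
  refine hδ ⟨_, (O_of_not_fixed h).trans (eq_smul_δ_of_eps_eq_zero hn ?_ ?_ ?_)⟩
  · rw [eps_add, eps_σmap_one hn, add_neg_cancel]
  · rw [eps_add, eps_σmap_last hn, add_neg_cancel]
  · intro k h2 hk
    rw [eps_add, eps_σmap_mid hn v h2 hk, eps_eq_zero_of_midNorm (by omega) h2 hk, add_zero]

lemma coord_δ_zero : coord (δ n) 0 = 1 := by rw [coord_δ (by omega), if_pos (by omega)]

lemma coord_δ_one : coord (δ n) 1 = 1 := by rw [coord_δ (by omega), if_pos (by omega)]

lemma coord_η_one : coord (η n) 1 = 1 := by rw [coord_η (by omega), if_pos (by omega)]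

lemma mem_Δ0'_iff {v : Q n} : v ∈ Δ0' n ↔ B n v v = 2 ∧ coord v 0 = 0 ∧ coord v 1 = 0 := by
  rw [← apply_one hn]
  have : v 0 = coord v 0 := apply_eq_coord v 0
  rw [← this]
  rfl

lemma eps_one_of_mem {β : Q n} (h : β ∈ Δ0' n) : eps β 1 = 0 := by
  obtain ⟨_, h0, h1⟩ := (mem_Δ0'_iff hn).1 h
  rw [eps_one hn, h0, h1, sub_zero]

lemma coord_O_zero_of_mem {β : Q n} (h : β ∈ Δ0' n) : coord (O n β) 0 = 0 := by
  obtain ⟨_, h0, h1⟩ := (mem_Δ0'_iff hn).1 h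
  unfold O
  split_ifs
  · exact h0
  · rw [coord_add, coord_σmap_zero hn, h0, h1, add_zero]

lemma neg_mem {β : Q n} (h : β ∈ Δ0' n) : -β ∈ Δ0' n := by
  rw [mem_Δ0'_iff hn] at h ⊢
  rw [coord_neg, coord_neg, h.2.1, h.2.2]
  exact ⟨by simpa [B] using h.1, by simp⟩

lemma σmap_mem {β : Q n} (h : β ∈ Δ0' n) : σmap n β ∈ Δ0' n := by
  rw [mem_Δ0'_iff hn] at h ⊢
  rw [coord_σmap_zero hn, coord_σmap_one hn, B_σmap_self hn]
  tauto

lemma B_add_smul_δ (v : Q n) (c : ℤ) : B n (v + c • δ n) (v + c • δ n) = B n v v := by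
  have e : ∀ k, 1 ≤ k → k ≤ n → eps (v + c • δ n) k = eps v k := fun k h1 hk => by
    rw [eps_add, eps_smul, eps_δ hn h1 hk, mul_zero, add_zero]
  rw [B_eq_sum hn, B_eq_sum hn]
  refine Finset.sum_congr rfl fun k hk => ?_
  rw [Finset.mem_Icc] at hk
  rw [e k hk.1 hk.2]

lemma B_add_η {v : Q n} (h1 : eps v 1 = 0) (hl : eps v n = 1) :
    B n (v + η n) (v + η n) = B n v v := by
  rw [B_self hn, B_self hn, eps_add, eps_add, h1, hl, eps_η_one hn, eps_η_last hn,
    midNorm_congr (v := v + η n) (w := v) fun k h2 hk => by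
      rw [eps_add, eps_η_mid hn h2 hk, add_zero]]
  ring

lemma σmap_add_smul_δ_eq_iff (v : Q n) (c : ℤ) :
    σmap n (v + c • δ n) = v + c • δ n ↔ σmap n v = v := by
  rw [σmap_add, σmap_smul, σmap_δ hn, add_left_inj]

lemma O_add_smul_δ_of_fixed {v : Q n} (h : σmap n v = v) (c : ℤ) :
    O n (v + c • δ n) = O n v + c • δ n := by
  rw [O_of_fixed h, O_of_fixed ((σmap_add_smul_δ_eq_iff hn v c).2 h)]

lemma O_add_smul_δ_of_not_fixed {v : Q n} (h : σmap n v ≠ v) (c : ℤ) :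
    O n (v + c • δ n) = O n v + (2 * c) • δ n := by
  rw [O_of_not_fixed h, O_of_not_fixed (mt (σmap_add_smul_δ_eq_iff hn v c).1 h), σmap_add,
    σmap_smul, σmap_δ hn, two_mul, add_smul]
  abel

lemma not_fixed_of_eps_last {v : Q n} (h : eps v n ≠ 0) : σmap n v ≠ v :=
  fun h' => h (eps_of_fixed hn h').2

lemma not_fixed_of_eps_one {v : Q n} (h : eps v 1 ≠ 0) : σmap n v ≠ v :=
  fun h' => h (eps_of_fixed hn h').1

lemma O_add_η {v : Q n} (h1 : eps v 1 = 0) (hl : eps v n = 1) :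
    O n (v + η n) = O n v + δ n := by
  rw [O_of_not_fixed (not_fixed_of_eps_last hn (by omega : eps v n ≠ 0)),
    O_of_not_fixed (not_fixed_of_eps_one hn (by rw [eps_add, h1, eps_η_one hn]; norm_num)),
    σmap_add, ← η_add_σmap_η hn]
  abel

/-- Up to translation by `δ`, every orbit sum comes from `Δ0'`. -/
lemma exists_O_eq_O_add {v : Q n} (hB : B n v v = 2) (hδ : ¬ ∃ m : ℤ, O n v = m • δ n) :
    ∃ β ∈ Δ0' n, ∃ c : ℤ, O n v = O n β + c • δ n := by
  have sub : ∀ w : Q n, B n w w = 2 → eps w 1 = 0 →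
      w + (-coord w 0) • δ n ∈ Δ0' n := by
    intro w hw h1
    rw [eps_one hn] at h1
    rw [mem_Δ0'_iff hn, B_add_smul_δ hn, coord_add, coord_add, coord_smul, coord_smul,
      coord_δ_zero hn, coord_δ_one hn]
    refine ⟨hw, by ring, by omega⟩
  by_cases h : σmap n v = v
  · refine ⟨_, sub v hB (eps_of_fixed hn h).1, coord v 0, ?_⟩
    rw [O_add_smul_δ_of_fixed hn h, neg_smul, neg_add_cancel_right]
  rcases eps_of_not_fixed hn hB h hδ with ⟨h1, -⟩ | ⟨hl, h1⟩
  · refine ⟨_, sub v hB h1, 2 * coord v 0, ?_⟩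
    rw [O_add_smul_δ_of_not_fixed hn h, mul_neg, neg_smul, neg_add_cancel_right]
  · have key : ∀ w : Q n, B n w w = 2 → eps w n = 0 → eps w 1 = 1 →
        ∃ β ∈ Δ0' n, ∃ c : ℤ, O n w = O n β + c • δ n := by
      intro w hw hl h1
      have e1 : eps (w - η n) 1 = 0 := by rw [eps_sub, h1, eps_η_one hn, sub_self]
      have el : eps (w - η n) n = 1 := by rw [eps_sub, hl, eps_η_last hn]; norm_num
      refine ⟨_, sub (w - η n) ?_ e1, 2 * coord (w - η n) 0 + 1, ?_⟩
      · rw [← B_add_η hn e1 el, sub_add_cancel, hw]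
      · rw [O_add_smul_δ_of_not_fixed hn (not_fixed_of_eps_last hn (by omega)), add_smul, mul_neg,
          neg_smul, add_assoc, neg_add_cancel_left, one_smul, ← O_add_η hn e1 el, sub_add_cancel]
    rcases h1 with h1 | h1
    · exact key v hB hl h1
    · rw [← O_σmap hn]
      exact key _ (by rwa [B_σmap_self hn]) (by rw [eps_σmap_last hn, hl, neg_zero])
        (by rw [eps_σmap_one hn, h1, neg_neg])

lemma mem_ulΔrePos_of_nonneg {β : Q n} (hβ : β ∈ Δ0' n) (c : ℤ)
    (h0 : ∀ i, 0 ≤ (O n β + c • δ n) i) : O n β + c • δ n ∈ ulΔrePos n := by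
  have hc : 0 ≤ c := by
    have := coord_nonneg h0 0
    rwa [coord_add, coord_smul, coord_O_zero_of_mem hn hβ, coord_δ_zero hn, zero_add,
      mul_one] at this
  lift c to ℕ using hc
  rcases nonneg_or_nonpos hn hβ.1 with h | h
  · exact Or.inl ⟨_, ⟨β, ⟨hβ, h⟩, rfl⟩, c, rfl⟩
  · have h' : ∀ i, 0 ≤ (-β) i := fun i => neg_nonneg.2 (h i)
    refine Or.inr ⟨_, ⟨-β, ⟨neg_mem hn hβ, h'⟩, rfl⟩, c, ?_, ?_⟩
    · by_contra hc
      obtain rfl : c = 0 := by omega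
      apply O_ne_zero h' (neg_mem hn hβ).1
      funext i
      have h1 := O_nonneg h' i
      have h2 := h0 i
      rw [O_neg] at h1 ⊢
      simp at h1 h2 ⊢
      omega
    · rw [O_neg, sub_neg_eq_add, add_comm]

/-- Conversely, such a translate is an orbit sum of a positive root. -/
lemma exists_O_eq {β : Q n} (hβ : β ∈ Δ0' n) {c : ℤ} (hc : 0 ≤ c)
    (h : (∀ i, 0 ≤ β i) ∨ 1 ≤ c) : ∃ v ∈ ΔrePos n, O n v = O n β + c • δ n := by
  have pos : ∀ w : Q n, B n w w = 2 → ∀ k, 0 < coord w k → w ∈ ΔrePos n := by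
    intro w hw k hk
    refine ⟨(nonneg_or_nonpos hn hw).resolve_right fun h' => ?_, hw⟩
    have := coord_nonneg (v := -w) (fun i => neg_nonneg.2 (h' i)) k
    rw [coord_neg] at this
    omega
  have shift : ∀ d : ℤ, 0 ≤ d → ((∀ i, 0 ≤ β i) ∨ 1 ≤ d) → β + d • δ n ∈ ΔrePos n := by
    intro d hd h
    have hB : B n (β + d • δ n) (β + d • δ n) = 2 := by rw [B_add_smul_δ hn]; exact hβ.1
    rcases h with h | h
    · exact ⟨fun i => add_nonneg (h i) (mul_nonneg hd (δ_pos i).le), hB⟩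
    · refine pos _ hB 0 ?_
      rw [coord_add, coord_smul, coord_δ_zero hn, ((mem_Δ0'_iff hn).1 hβ).2.1]
      omega
  by_cases hf : σmap n β = β
  · exact ⟨_, shift c hc h, O_add_smul_δ_of_fixed hn hf c⟩
  obtain ⟨l, rfl | rfl⟩ := Int.even_or_odd' c
  · refine ⟨_, shift l (by omega) (h.imp_right fun _ => by omega), ?_⟩
    rw [O_add_smul_δ_of_not_fixed hn hf]
  · have key : ∀ γ ∈ Δ0' n, eps γ n = 1 →
        ∃ v ∈ ΔrePos n, O n v = O n γ + (2 * l + 1) • δ n := by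
      intro γ hγ hl
      have h1 := eps_one_of_mem hn hγ
      refine ⟨γ + η n + l • δ n, pos _ ?_ 1 ?_, ?_⟩
      · rw [B_add_smul_δ hn, B_add_η hn h1 hl]
        exact hγ.1
      · rw [coord_add, coord_add, coord_smul, coord_δ_one hn, coord_η_one hn,
          ((mem_Δ0'_iff hn).1 hγ).2.2]
        omega
      · rw [O_add_smul_δ_of_not_fixed hn (not_fixed_of_eps_one hn
          (by rw [eps_add, h1, eps_η_one hn]; norm_num)), O_add_η hn h1 hl, add_smul, one_smul]
        abel
    have hm := midNorm_nonneg β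
    have hB := hβ.1
    have h1 := eps_one_of_mem hn hβ
    rw [B_self hn, h1] at hB
    have b1 : -1 ≤ eps β n := by nlinarith
    have b2 : eps β n ≤ 1 := by nlinarith
    have b3 : eps β n ≠ 0 := fun h' => hf (σmap_eq_self hn h1 h')
    rcases (by omega : eps β n = 1 ∨ eps β n = -1) with hl | hl
    · exact key β hβ hl
    · rw [← O_σmap hn]
      exact key _ (σmap_mem hn hβ) (by rw [eps_σmap_last hn, hl, neg_neg])

lemma O_not_smul_δ {β : Q n} (hβ : β ∈ Δ0'Pos n) (c : ℤ) :
    ¬ ∃ m : ℤ, O n β + c • δ n = m • δ n := by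
  rintro ⟨m, hm⟩
  have e : O n β = (m - c) • δ n := by rw [sub_smul, ← hm, add_sub_cancel_right]
  have h0 := coord_O_zero_of_mem hn hβ.1
  rw [e, coord_smul, coord_δ_zero hn, mul_one] at h0
  rw [h0, zero_smul] at e
  exact O_ne_zero hβ.2 hβ.1.1 e

lemma eq_of_eps_eq {v w : Q n} (h1 : eps v 1 = eps w 1) (hl : eps v n = eps w n)
    (h : ∀ k, 2 ≤ k → k ≤ n - 1 → eps v k = eps w k)
    (hs : v + σmap n v = w + σmap n w) : v = w := by
  have e : v - w = coord (v - w) 0 • δ n :=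
    eq_smul_δ_of_eps_eq_zero hn (by rw [eps_sub, h1, sub_self]) (by rw [eps_sub, hl, sub_self])
      fun k h2 hk => by rw [eps_sub, h k h2 hk, sub_self]
  have h0 := congrArg (coord · 0) hs
  simp only [coord_add, coord_σmap_zero hn] at h0
  rw [eps_one hn, eps_one hn] at h1
  rw [coord_sub, (by omega : coord v 0 - coord w 0 = 0), zero_smul] at e
  exact sub_eq_zero.1 e

lemma not_O_eq_of_fixed_of_not_fixed {v w : Q n} (hv : B n v v = 2) (hvf : σmap n v = v)
    (hwf : σmap n w ≠ w) : O n v ≠ O n w := by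
  intro e
  rw [O_of_fixed hvf, O_of_not_fixed hwf] at e
  obtain ⟨h1, hl⟩ := eps_of_fixed hn hvf
  rw [B_self hn, h1, hl] at hv
  have : midNorm v = 4 * midNorm w := by
    rw [midNorm, midNorm, Finset.mul_sum]
    refine Finset.sum_congr rfl fun k hk => ?_
    rw [Finset.mem_Icc] at hk
    rw [e, eps_add, eps_σmap_mid hn w hk.1 hk.2]
    ring
  omega

lemma eq_or_eq_σmap_of_O_eq {v w : Q n} (hv : B n v v = 2) (hw : B n w w = 2)
    (h : O n v = O n w) (hδ : ¬ ∃ m : ℤ, O n v = m • δ n) : w = v ∨ w = σmap n v := by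
  by_cases hvf : σmap n v = v <;> by_cases hwf : σmap n w = w
  · left
    rw [← O_of_fixed hvf, ← O_of_fixed hwf, h]
  · exact absurd h (not_O_eq_of_fixed_of_not_fixed hn hv hvf hwf)
  · exact absurd h.symm (not_O_eq_of_fixed_of_not_fixed hn hw hwf hvf)
  have tv := eps_of_not_fixed hn hv hvf hδ
  have tw := eps_of_not_fixed hn hw hwf (h ▸ hδ)
  rw [O_of_not_fixed hvf, O_of_not_fixed hwf] at h
  have hm : ∀ k, 2 ≤ k → k ≤ n - 1 → eps v k = eps w k := by
    intro k h2 hk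
    have := congrArg (eps · k) h
    simp only [eps_add, eps_σmap_mid hn _ h2 hk] at this
    omega
  have h0 := congrArg (coord · 0) h
  simp only [coord_add, coord_σmap_zero hn] at h0
  have hpar : eps v 1 % 2 = eps w 1 % 2 := by
    rw [eps_one hn, eps_one hn]
    omega
  rcases (by omega : (eps v 1 = eps w 1 ∧ eps v n = eps w n) ∨
    (-eps v 1 = eps w 1 ∧ -eps v n = eps w n)) with ⟨h1, hl⟩ | ⟨h1, hl⟩
  · exact Or.inl (eq_of_eps_eq hn h1 hl hm h).symm
  · right
    refine (eq_of_eps_eq hn ?_ ?_ ?_ ?_).symm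
    · rw [eps_σmap_one hn, h1]
    · rw [eps_σmap_last hn, hl]
    · intro k h2 hk
      rw [eps_σmap_mid hn v h2 hk, hm k h2 hk]
    · rw [σmap_σmap hn, add_comm, h]

lemma orb_eq (v : Q n) : orb n v = {v, σmap n v} := by
  ext w
  constructor
  · rintro ⟨k, rfl⟩
    induction k with
    | zero => simp
    | succ k ih =>
      rw [Function.iterate_succ_apply']
      rcases ih with ih | ih
      · rw [ih]; simp
      · rw [Set.mem_singleton_iff.1 ih, σmap_σmap hn]; simp
  · rintro (rfl | rfl)
    · exact ⟨0, rfl⟩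
    · exact ⟨1, rfl⟩

lemma orb_σmap (v : Q n) : orb n (σmap n v) = orb n v := by
  rw [orb_eq hn, orb_eq hn, σmap_σmap hn, Set.pair_comm]

lemma finsum_orb (v : Q n) : ∑ᶠ u ∈ orb n v, u = O n v := by
  rw [orb_eq hn]
  by_cases h : σmap n v = v
  · rw [O_of_fixed h, h, Set.pair_eq_singleton, finsum_mem_singleton]
  · rw [O_of_not_fixed h, finsum_mem_pair (Ne.symm h)]

lemma O_mem_ulΔrePos {v : Q n} (hv : v ∈ ΔrePos n) (hδ : ¬ ∃ m : ℤ, O n v = m • δ n) :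
    O n v ∈ ulΔrePos n := by
  obtain ⟨β, hβ, c, e⟩ := exists_O_eq_O_add hn hv.2 hδ
  rw [e]
  exact mem_ulΔrePos_of_nonneg hn hβ c fun i => e ▸ O_nonneg hv.1 i

lemma exists_of_mem_ulΔrePos {y : Q n} (hy : y ∈ ulΔrePos n) :
    (∃ v ∈ ΔrePos n, O n v = y) ∧ ¬ ∃ m : ℤ, y = m • δ n := by
  rcases hy with ⟨_, ⟨β, hβ, rfl⟩, m, rfl⟩ | ⟨_, ⟨β, hβ, rfl⟩, m, hm, rfl⟩
  · exact ⟨exists_O_eq hn hβ.1 (by omega) (Or.inl hβ.2), O_not_smul_δ hn hβ m⟩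
  · constructor
    · obtain ⟨v, hv, e⟩ := exists_O_eq hn (neg_mem hn hβ.1) (c := m) (by omega)
        (Or.inr (by omega))
      exact ⟨v, hv, by rw [e, O_neg, neg_add_eq_sub]⟩
    · rintro ⟨k, hk⟩
      refine O_not_smul_δ hn hβ (-m) ⟨-k, ?_⟩
      rw [neg_smul, neg_smul, ← hk]
      abel

end

theorem statement10 (n : ℕ) (hn : 4 ≤ n) :
    (∀ v ∈ ΔrePos n,
      (∃ m : ℤ, 0 < m ∧ O n v = m • δ n) ∨ O n v ∈ ulΔrePos n) ∧
    Set.BijOn (fun ω => ∑ᶠ u ∈ ω, u)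
      {ω ∈ Orbits n | ¬ ∃ m : ℤ, (∑ᶠ u ∈ ω, u) = m • δ n}
      (ulΔrePos n) := by
  refine ⟨fun v hv => ?_, ?_, ?_, ?_⟩
  · by_cases hδ : ∃ m : ℤ, O n v = m • δ n
    · left
      obtain ⟨m, hm⟩ := hδ
      refine ⟨m, ?_, hm⟩
      have h0 := coord_nonneg (O_nonneg hv.1) 0
      rw [hm, coord_smul, coord_δ_zero hn, mul_one] at h0
      refine h0.lt_of_ne fun e => O_ne_zero hv.1 hv.2 ?_
      rw [hm, ← e, zero_smul]
    · exact Or.inr (O_mem_ulΔrePos hn hv hδ)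
  · rintro _ ⟨⟨v, hv, rfl⟩, hδ⟩
    simp only [finsum_orb hn] at hδ ⊢
    exact O_mem_ulΔrePos hn hv hδ
  · rintro _ ⟨⟨v, hv, rfl⟩, hδ⟩ _ ⟨⟨w, hw, rfl⟩, -⟩ h
    simp only [finsum_orb hn] at hδ h
    rcases eq_or_eq_σmap_of_O_eq hn hv.2 hw.2 h hδ with rfl | rfl
    · rfl
    · exact (orb_σmap hn v).symm
  · intro y hy
    obtain ⟨⟨v, hv, rfl⟩, hδ⟩ := exists_of_mem_ulΔrePos hn hy
    refine ⟨orb n v, ⟨⟨v, hv, rfl⟩, ?_⟩, finsum_orb hn v⟩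
    rwa [finsum_orb hn]

end Stmt10
end
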